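/- arXiv:2009.05869 — 2 statements merged into one kernel-verified Lean document; each statement's English description precedes it below -/
import Mathlib

section
/- Fix integers k ≥ 1 and d ≥ 0 and fix infinite words w, w' over [k]. For every L ≥ 0 and every i with 0 ≤ i ≤ d: if i ∈ A[L] then P_i(L+1) = P_i(L) + 1; and if i ∉ A[L] then P_i(L+1) = max(P_i(L), P_{i−1}(L+1) + 1), where for i = 0 the convention P_{−1}(L+1) = −∞ makes this read P_0(L+1) = P_0(L). -/
/-- `u` is `d`-almost contained in `v`: one may remove at most `d` symbols from `u`
and obtain a subsequence of `v`. -/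
def AlmostIn (d : ℕ) (u v : List ℕ) : Prop :=
  ∃ s : List ℕ, s.Sublist u ∧ u.length ≤ s.length + d ∧ s.Sublist v

/-- The length-`m` prefix of an infinite word `w : ℕ → ℕ`. -/
def pre (w : ℕ → ℕ) (m : ℕ) : List ℕ :=
  (List.range m).map w

/-- `Pd i L w w'` is `P_i(L)`: the length of the longest prefix of the infinite word `w`
that is `i`-almost contained in the length-`L` prefix of `w'`. -/
noncomputable def Pd (i L : ℕ) (w w' : ℕ → ℕ) : ℕ :=
  sSup {m | AlmostIn i (pre w m) (pre w' L)}

theorem pre_succ (w : ℕ → ℕ) (m : ℕ) : pre w (m + 1) = pre w m ++ [w m] := by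
  simp [pre, List.range_succ]

theorem length_pre (w : ℕ → ℕ) (m : ℕ) : (pre w m).length = m := by
  simp [pre]

theorem sublist_concat_cases {s u : List ℕ} {a : ℕ} (h : s.Sublist (u ++ [a])) :
    s.Sublist u ∨ ∃ t, s = t ++ [a] ∧ t.Sublist u := by
  obtain ⟨t, r, rfl, ht, hr⟩ := List.sublist_append_iff.1 h
  rcases List.sublist_singleton.1 hr with rfl | rfl
  · exact Or.inl (by simpa using ht)
  · exact Or.inr ⟨t, rfl, ht⟩

theorem almostIn_nil (i : ℕ) (v : List ℕ) : AlmostIn i [] v :=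
  ⟨[], by simp, by simp, by simp⟩

theorem AlmostIn.append_right {i : ℕ} {u v : List ℕ} (h : AlmostIn i u v) (r : List ℕ) :
    AlmostIn i u (v ++ r) := by
  obtain ⟨s, hu, hl, hv⟩ := h
  exact ⟨s, hu, hl, hv.trans (List.sublist_append_left v r)⟩

theorem AlmostIn.concat_left {i : ℕ} {u v : List ℕ} (h : AlmostIn i u v) (a : ℕ) :
    AlmostIn (i + 1) (u ++ [a]) v := by
  obtain ⟨s, hu, hl, hv⟩ := h
  refine ⟨s, hu.trans (List.sublist_append_left u [a]), ?_, hv⟩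
  simp only [List.length_append, List.length_singleton]
  omega

theorem AlmostIn.concat_concat {i : ℕ} {u v : List ℕ} (h : AlmostIn i u v) (a : ℕ) :
    AlmostIn i (u ++ [a]) (v ++ [a]) := by
  obtain ⟨s, hu, hl, hv⟩ := h
  refine ⟨s ++ [a], hu.append_right [a], ?_, hv.append_right [a]⟩
  simp only [List.length_append, List.length_singleton]
  omega

theorem AlmostIn.of_concat_left {i : ℕ} {u v : List ℕ} {a : ℕ} (h : AlmostIn i (u ++ [a]) v) :
    AlmostIn i u v := by
  obtain ⟨s, hu, hl, hv⟩ := h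
  simp only [List.length_append, List.length_singleton] at hl
  rcases sublist_concat_cases hu with hs | ⟨t, rfl, ht⟩
  · exact ⟨s, hs, by omega, hv⟩
  · simp only [List.length_append, List.length_singleton] at hl
    exact ⟨t, ht, by omega, (List.sublist_append_left t [a]).trans hv⟩

/-- The last symbols of both words are matched, or the last symbol of the contained word is
removed, or the last symbol of the containing word is not used. -/
theorem AlmostIn.concat_cases {i : ℕ} {u v : List ℕ} {a b : ℕ}
    (h : AlmostIn i (u ++ [a]) (v ++ [b])) :
    (a = b ∧ AlmostIn i u v) ∨ (∃ j, i = j + 1 ∧ AlmostIn j u (v ++ [b])) ∨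
      AlmostIn i (u ++ [a]) v := by
  obtain ⟨s, hu, hl, hv⟩ := h
  have hl' := hl
  simp only [List.length_append, List.length_singleton] at hl'
  rcases sublist_concat_cases hu with hs | ⟨t, rfl, ht⟩
  · have hle := hs.length_le
    exact Or.inr (Or.inl ⟨i - 1, by omega, s, hs, by omega, hv⟩)
  · rcases sublist_concat_cases hv with hs | ⟨r, hr, hrv⟩
    · exact Or.inr (Or.inr ⟨_, hu, hl, hs⟩)
    · obtain ⟨rfl, hab⟩ := List.append_inj' hr rfl
      simp only [List.length_append, List.length_singleton] at hl'
      exact Or.inl ⟨by simpa using hab, t, ht, by omega, hrv⟩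

theorem AlmostIn.of_pre_le {i m n : ℕ} {w : ℕ → ℕ} {v : List ℕ} (hmn : m ≤ n)
    (h : AlmostIn i (pre w n) v) : AlmostIn i (pre w m) v := by
  induction n, hmn using Nat.le_induction with
  | base => exact h
  | succ n _ ih =>
    rw [pre_succ] at h
    exact ih h.of_concat_left

theorem le_Pd_iff {i L m : ℕ} {w w' : ℕ → ℕ} :
    m ≤ Pd i L w w' ↔ AlmostIn i (pre w m) (pre w' L) := by
  have hbdd : BddAbove {m | AlmostIn i (pre w m) (pre w' L)} := by
    refine ⟨L + i, ?_⟩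
    rintro n ⟨s, -, hl, hv⟩
    have hle := hv.length_le
    rw [length_pre] at hl hle
    omega
  refine ⟨fun h => ?_, fun h => le_csSup hbdd h⟩
  exact AlmostIn.of_pre_le h
    (Nat.sSup_mem (s := {m | AlmostIn i (pre w m) (pre w' L)}) ⟨0, almostIn_nil i _⟩ hbdd)

/-- One more symbol in the containing word gains at most one symbol of prefix. -/
theorem AlmostIn.pre_of_succ_succ {w w' : ℕ → ℕ} {L m : ℕ} : ∀ {i : ℕ},
    AlmostIn i (pre w (m + 1)) (pre w' (L + 1)) → AlmostIn i (pre w m) (pre w' L) := by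
  induction m with
  | zero => exact fun _ => almostIn_nil _ _
  | succ m ih =>
    intro i h
    rw [pre_succ w (m + 1), pre_succ w' L] at h
    rcases h.concat_cases with ⟨-, hm⟩ | ⟨j, rfl, hm⟩ | hm
    · exact hm
    · rw [← pre_succ w' L] at hm
      rw [pre_succ w m]
      exact (ih hm).concat_left _
    · exact hm.of_concat_left

theorem Pd_le_Pd_succ (i L : ℕ) (w w' : ℕ → ℕ) : Pd i L w w' ≤ Pd i (L + 1) w w' := by
  rw [le_Pd_iff, pre_succ w' L]
  exact (le_Pd_iff.1 le_rfl).append_right _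

theorem Pd_succ_le (i L : ℕ) (w w' : ℕ → ℕ) : Pd i (L + 1) w w' ≤ Pd i L w w' + 1 := by
  by_contra! h
  have := le_Pd_iff.2 (AlmostIn.pre_of_succ_succ (le_Pd_iff.1 (Nat.succ_le_of_lt h)))
  omega

theorem Pd_add_one_le (i L : ℕ) (w w' : ℕ → ℕ) : Pd i L w w' + 1 ≤ Pd (i + 1) L w w' := by
  rw [le_Pd_iff, pre_succ]
  exact (le_Pd_iff.1 le_rfl).concat_left _

/-- If the next symbols do not match, a longer prefix is reached only by removing a symbol. -/
theorem Pd_succ_cases {i L : ℕ} {w w' : ℕ → ℕ} (hne : w (Pd i L w w') ≠ w' L) :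
    Pd i (L + 1) w w' ≤ Pd i L w w' ∨
      ∃ j, i = j + 1 ∧ Pd i (L + 1) w w' ≤ Pd j (L + 1) w w' + 1 := by
  by_cases hle : Pd i (L + 1) w w' ≤ Pd i L w w'
  · exact Or.inl hle
  have heq : Pd i (L + 1) w w' = Pd i L w w' + 1 := by
    have := Pd_succ_le i L w w'
    omega
  have h := le_Pd_iff.1 heq.ge
  rw [pre_succ w, pre_succ w' L] at h
  rcases h.concat_cases with ⟨hab, -⟩ | ⟨j, hj, h⟩ | h
  · exact absurd hab hne
  · rw [← pre_succ w' L] at h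
    have := le_Pd_iff.2 h
    exact Or.inr ⟨j, hj, by omega⟩
  · rw [← pre_succ w] at h
    have := le_Pd_iff.2 h
    omega

/-- Fix `k ≥ 1`, `d ≥ 0` and infinite words `w, w'` over `[k] = {1,…,k}`.
For every `L` and every `i ≤ d`: if `i ∈ A[L]` (that is, `w[P_i(L)] = w'[L]`) then
`P_i(L+1) = P_i(L) + 1`; if `i ∉ A[L]` then `P_0(L+1) = P_0(L)` when `i = 0`, and
`P_i(L+1) = max(P_i(L), P_{i-1}(L+1) + 1)` when `i ≥ 1`. -/
theorem stmt5 (k d : ℕ) (hk : 1 ≤ k) (w w' : ℕ → ℕ)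
    (hw : ∀ j, 1 ≤ w j ∧ w j ≤ k) (hw' : ∀ j, 1 ≤ w' j ∧ w' j ≤ k)
    (L : ℕ) (i : ℕ) (hi : i ≤ d) :
    (w (Pd i L w w') = w' L → Pd i (L + 1) w w' = Pd i L w w' + 1) ∧
    (w (Pd i L w w') ≠ w' L →
      (i = 0 → Pd 0 (L + 1) w w' = Pd 0 L w w') ∧
      (1 ≤ i → Pd i (L + 1) w w' = max (Pd i L w w') (Pd (i - 1) (L + 1) w w' + 1))) := by
  have hmono := Pd_le_Pd_succ i L w w'
  refine ⟨fun heq => ?_, fun hne => ⟨?_, fun hpos => ?_⟩⟩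
  · refine le_antisymm (Pd_succ_le i L w w') ?_
    rw [le_Pd_iff, pre_succ w, pre_succ w' L, heq]
    exact (le_Pd_iff.1 le_rfl).concat_concat _
  · rintro rfl
    rcases Pd_succ_cases hne with h | ⟨j, hj, -⟩
    · exact le_antisymm h hmono
    · omega
  · obtain ⟨j, rfl⟩ : ∃ j, i = j + 1 := ⟨i - 1, by omega⟩
    rw [Nat.add_sub_cancel]
    refine le_antisymm ?_ (max_le hmono (Pd_add_one_le j (L + 1) w w'))
    rcases Pd_succ_cases hne with h | ⟨j', hj, h⟩
    · exact h.trans (le_max_left _ _)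
    · obtain rfl : j = j' := by omega
      exact h.trans (le_max_right _ _)
end

section
/- There exist absolute constants C, C' > 0 such that the following holds for all integers k ≥ 1, n ≥ 2 and all p ∈ (0,1] with p·n/log n ≥ C'. Pick m ~ Binom(n,p), and then choose w ~ [k]^m uniformly at random. Then | E[LNDS(w)] − pn/k − 2√(pn) | ≤ 2√(pn) · C · ( k^{−2/3} + (k² + k·log(pn))/(pn)^{1/2} ). -/
/-- Length of a longest non-decreasing subsequence of a word. -/
noncomputable def LNDS {α : Type*} [LinearOrder α] (w : List α) : ℕ :=
  sSup {n | ∃ u : List α, u.Sublist w ∧ u.Chain' (· ≤ ·) ∧ u.length = n}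

/-- Expected LNDS length of a uniformly random word of length `m` over the alphabet
`[k] = {1, …, k}`. -/
noncomputable def expLNDS (k m : ℕ) : ℝ :=
  (∑ u : Fin m → Fin k, (LNDS (List.ofFn fun i => (u i : ℕ) + 1) : ℝ)) / (k : ℝ) ^ m

/-- Expected LNDS length of a word obtained by first picking `m ~ Binom(n, p)` and then
choosing `w ~ [k]^m` uniformly at random. -/
noncomputable def expLNDSBinom (k n : ℕ) (p : ℝ) : ℝ :=
  ∑ m ∈ Finset.range (n + 1),
    (n.choose m : ℝ) * p ^ m * (1 - p) ^ (n - m) * expLNDS k m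

/-- The content of the first row of a tableau with entries in `Fin k`: how many copies of each
letter it holds. -/
@[reducible] def RowState : ℕ → Type
  | 0 => Unit
  | k + 1 => ℕ × RowState k

namespace RowState

/-- The empty row. -/
def empty : (k : ℕ) → RowState k
  | 0 => ()
  | k + 1 => (0, empty k)

/-- Remove one copy of the smallest letter, if there is one. -/
def bump : (k : ℕ) → RowState k → RowState k
  | 0, s => s
  | k + 1, s => if s.1 = 0 then (0, bump k s.2) else (s.1 - 1, s.2)

/-- Row insertion of a letter: it replaces the smallest larger letter, if there is one. -/
def ins : (k : ℕ) → Fin k → RowState k → RowState k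
  | 0, b, _ => b.elim0
  | k + 1, b, s => Fin.cases (s.1 + 1, bump k s.2) (fun c => (s.1, ins k c s.2)) b

/-- The number of letters in the row. -/
def size : (k : ℕ) → RowState k → ℕ
  | 0, _ => 0
  | k + 1, s => s.1 + size k s.2

/-- The number of letters `≤ j` in the row. -/
def cum : (k : ℕ) → RowState k → Fin k → ℕ
  | 0, _, j => j.elim0
  | k + 1, s, j => Fin.cases s.1 (fun i => s.1 + cum k s.2 i) j

lemma cum_empty : ∀ (k : ℕ) (j : Fin k), cum k (empty k) j = 0
  | 0, j => j.elim0
  | k + 1, j => by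
    refine Fin.cases ?_ (fun i => ?_) j
    · rfl
    · simpa [cum, empty] using cum_empty k i

lemma size_empty : ∀ k : ℕ, size k (empty k) = 0
  | 0 => rfl
  | k + 1 => by simpa [size, empty] using size_empty k

lemma cum_bump : ∀ (k : ℕ) (s : RowState k) (j : Fin k), cum k (bump k s) j = cum k s j - 1
  | 0, _, j => j.elim0
  | k + 1, s, j => by
    have ih := cum_bump k s.2
    refine Fin.cases ?_ (fun i => ?_) j
    · by_cases h : s.1 = 0 <;> simp [bump, cum, h]
    · by_cases h : s.1 = 0
      · simp [bump, cum, h, ih i]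
      · simp [bump, cum, h]; omega

lemma cum_ins : ∀ (k : ℕ) (b : Fin k) (s : RowState k) (j : Fin k),
    cum k (ins k b s) j = if j < b then cum k s j else max (cum k s j) (cum k s b + 1)
  | 0, b, _, _ => b.elim0
  | k + 1, b, s, j => by
    have ih := cum_ins k
    refine Fin.cases ?_ (fun c => ?_) b
    · refine Fin.cases ?_ (fun i => ?_) j
      · simp [ins, cum]
      · simp [ins, cum, cum_bump]; omega
    · refine Fin.cases ?_ (fun i => ?_) j
      · simp [ins, cum]
      · simp only [ins, cum, Fin.cases_succ, ih, Fin.succ_lt_succ_iff]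
        split_ifs <;> omega

lemma cum_monotone : ∀ (k : ℕ) (s : RowState k), Monotone (cum k s)
  | 0, _ => fun i => i.elim0
  | k + 1, s => by
    intro i j
    refine Fin.cases ?_ (fun i => ?_) i <;> refine Fin.cases ?_ (fun j => ?_) j
    · simp
    · simp [cum]
    · simp
    · intro h
      have := cum_monotone k s.2 (Fin.succ_le_succ_iff.1 h)
      simpa [cum] using this

lemma cum_le_size : ∀ (k : ℕ) (s : RowState k) (j : Fin k), cum k s j ≤ size k s
  | 0, _, j => j.elim0
  | k + 1, s, j => by
    have ih := cum_le_size k s.2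
    refine Fin.cases ?_ (fun i => ?_) j
    · simp [cum, size]
    · simpa [cum, size] using ih i

lemma cum_last : ∀ (k : ℕ) (s : RowState (k + 1)), cum (k + 1) s (Fin.last k) = size (k + 1) s
  | 0, s => by
    rw [show Fin.last 0 = 0 from rfl]
    simp [cum, size]
  | k + 1, s => by
    have ih := cum_last k s.2
    rw [← Fin.succ_last]
    exact congrArg (s.1 + ·) ih

lemma size_le_of_cum_le (k c : ℕ) (s s' : RowState k) (h : ∀ j, cum k s j ≤ cum k s' j + c) :
    size k s ≤ size k s' + c := by
  cases k with
  | zero => simp [size]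
  | succ k => rw [← cum_last, ← cum_last]; exact h _

lemma cum_ins_le_of_cum_le {k c : ℕ} {s s' : RowState k} (h : ∀ j, cum k s j ≤ cum k s' j + c)
    (b j : Fin k) : cum k (ins k b s) j ≤ cum k (ins k b s') j + c := by
  have h1 := h j
  have h2 := h b
  rw [cum_ins, cum_ins]
  split_ifs <;> omega

lemma size_le_size_ins (k : ℕ) (b : Fin k) (s : RowState k) : size k s ≤ size k (ins k b s) := by
  have := size_le_of_cum_le k 0 s (ins k b s) (fun j => by rw [cum_ins]; split_ifs <;> omega)
  omega

/-- The row obtained by inserting the letters of a word one after the other. -/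
def insWord {k : ℕ} (s : RowState k) (w : List (Fin k)) : RowState k :=
  w.foldl (fun s b => ins k b s) s

lemma isGreatest_cum_insWord {k : ℕ} (w : List (Fin k)) : ∀ j : Fin k,
    IsGreatest {n | ∃ u : List (Fin k), u.Sublist w ∧ u.IsChain (· ≤ ·) ∧ (∀ x ∈ u, x ≤ j) ∧
      u.length = n} (cum k (insWord (empty k) w) j) := by
  induction w using List.reverseRecOn with
  | nil =>
    intro j
    constructor
    · exact ⟨[], by simp, by simp, by simp, by simp [insWord, cum_empty]⟩
    · rintro n ⟨u, hu, -, -, rfl⟩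
      simp [List.sublist_nil.1 hu]
  | append_singleton w b ih =>
    intro j
    have hstep : insWord (empty k) (w ++ [b]) = ins k b (insWord (empty k) w) := by
      simp [insWord]
    rw [hstep, cum_ins]
    constructor
    · obtain ⟨u, h1, h2, h3, h4⟩ := (ih j).1
      obtain ⟨v, g1, g2, g3, g4⟩ := (ih b).1
      have hu : cum k (insWord (empty k) w) j ∈ {n | ∃ u : List (Fin k),
          u.Sublist (w ++ [b]) ∧ u.IsChain (· ≤ ·) ∧ (∀ x ∈ u, x ≤ j) ∧ u.length = n} :=
        ⟨u, h1.trans (List.sublist_append_left _ _), h2, h3, h4⟩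
      split_ifs with hjb
      · exact hu
      · rcases le_total (cum k (insWord (empty k) w) b + 1) (cum k (insWord (empty k) w) j)
          with hle | hle
        · rwa [max_eq_left hle]
        · rw [max_eq_right hle]
          refine ⟨v ++ [b], g1.append_right _, ?_, ?_, by simp [g4]⟩
          · rw [List.isChain_iff_pairwise] at g2 ⊢
            rw [List.pairwise_append]
            exact ⟨g2, by simp, fun x hx y hy => by simp at hy; subst hy; exact g3 x hx⟩
          · intro x hx
            rcases List.mem_append.1 hx with hx | hx
            · exact (g3 x hx).trans (not_lt.1 hjb)
            · simp at hx; subst hx; exact not_lt.1 hjb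
    · rintro n ⟨u, hu, hch, hle, rfl⟩
      obtain ⟨u₁, u₂, rfl, hu₁, hu₂⟩ := List.sublist_append_iff.1 hu
      rw [List.isChain_iff_pairwise, List.pairwise_append] at hch
      have h₁ : u₁.length ≤ cum k (insWord (empty k) w) j :=
        (ih j).2 ⟨u₁, hu₁, List.isChain_iff_pairwise.2 hch.1,
          fun x hx => hle x (List.mem_append_left _ hx), rfl⟩
      rcases List.sublist_singleton.1 hu₂ with rfl | rfl
      · simp only [List.append_nil]
        split_ifs
        · exact h₁
        · exact h₁.trans (le_max_left _ _)
      · have hbj : b ≤ j := hle b (by simp)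
        have h₂ : u₁.length ≤ cum k (insWord (empty k) w) b :=
          (ih b).2 ⟨u₁, hu₁, List.isChain_iff_pairwise.2 hch.1,
            fun x hx => hch.2.2 x hx b (by simp), rfl⟩
        rw [if_neg (not_lt.2 hbj)]
        simp
        omega

lemma LNDS_eq_size {k : ℕ} (w : List (Fin k)) :
    LNDS (w.map fun x : Fin k => (x : ℕ) + 1) = size k (insWord (empty k) w) := by
  unfold LNDS
  apply IsGreatest.csSup_eq
  cases k with
  | zero =>
    have hw : w = [] := List.eq_nil_of_length_eq_zero (by
      cases w with
      | nil => rfl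
      | cons a _ => exact a.elim0)
    subst hw
    constructor
    · exact ⟨[], by simp, List.isChain_nil, rfl⟩
    · rintro n ⟨u, hu, -, rfl⟩
      simp at hu
      simp [hu, size]
  | succ k =>
    have h := isGreatest_cum_insWord w (Fin.last k)
    rw [cum_last] at h
    constructor
    · obtain ⟨u, h1, h2, -, h4⟩ := h.1
      refine ⟨u.map fun x : Fin (k + 1) => (x : ℕ) + 1, h1.map _, ?_, by simpa using h4⟩
      refine (List.isChain_map _).2 ?_
      exact h2.imp (fun a b hab => by simpa using hab)
    · rintro n ⟨u, hu, hch, rfl⟩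
      obtain ⟨v, hv, rfl⟩ := List.sublist_map_iff.1 hu
      replace hch := (List.isChain_map _).1 hch
      exact h.2 ⟨v, hv, hch.imp (fun a b hab => by simpa using hab),
        fun x _ => Fin.le_last x, by simp⟩

/-- Sum of a function of the row over all insertions of one letter. -/
def insSum {R : Type*} [AddCommMonoid R] {k : ℕ} (φ : RowState k → R) (s : RowState k) : R :=
  ∑ b : Fin k, φ (ins k b s)

lemma sum_insWord {R : Type*} [AddCommMonoid R] {k : ℕ} (φ : RowState k → R) (m : ℕ) :
    ∀ s : RowState k, ∑ u : Fin m → Fin k, φ (insWord s (List.ofFn u)) = insSum^[m] φ s := by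
  induction m with
  | zero => intro s; simp [insWord]
  | succ m ih =>
    intro s
    rw [Function.iterate_succ_apply', insSum,
      ← (Fin.consEquiv fun _ : Fin (m + 1) => Fin k).sum_comp, Fintype.sum_prod_type]
    refine Finset.sum_congr rfl fun b _ => ?_
    rw [← ih]
    refine Finset.sum_congr rfl fun u _ => ?_
    simp [Fin.consEquiv, insWord, List.ofFn_succ]

lemma iterate_insSum_const {k : ℕ} (c m : ℕ) (s : RowState k) :
    insSum^[m] (fun _ => c) s = k ^ m * c := by
  rw [← sum_insWord (fun _ : RowState k => c)]
  simp

/-- Sum of the LNDS lengths of all words of length `m` over `k` letters. -/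
def totalLNDS (k m : ℕ) : ℕ := insSum^[m] (size k) (empty k)

lemma expLNDS_eq (k m : ℕ) : expLNDS k m = (totalLNDS k m : ℝ) / (k : ℝ) ^ m := by
  unfold expLNDS totalLNDS
  rw [← sum_insWord]
  push_cast
  congr 1
  refine Finset.sum_congr rfl fun u _ => ?_
  rw [← LNDS_eq_size, List.map_ofFn]
  rfl

lemma iterate_insSum_size_le {k c : ℕ} (m : ℕ) : ∀ {s s' : RowState k},
    (∀ j, cum k s j ≤ cum k s' j + c) →
    insSum^[m] (size k) s ≤ insSum^[m] (size k) s' + k ^ m * c := by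
  induction m with
  | zero => intro s s' h; simpa using size_le_of_cum_le k c s s' h
  | succ m ih =>
    intro s s' h
    rw [Function.iterate_succ_apply']
    rw [insSum, insSum]
    calc _ ≤ ∑ b : Fin k, (insSum^[m] (size k) (ins k b s') + k ^ m * c) :=
          Finset.sum_le_sum fun b _ => ih (cum_ins_le_of_cum_le h b)
      _ = _ := by rw [Finset.sum_add_distrib]; simp; ring

lemma iterate_insSum_le_iterate_insSum {k : ℕ} (m : ℕ) {φ ψ : RowState k → ℕ}
    (h : ∀ s, φ s ≤ ψ s) (s : RowState k) : insSum^[m] φ s ≤ insSum^[m] ψ s := by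
  rw [← sum_insWord, ← sum_insWord]
  exact Finset.sum_le_sum fun u _ => h _

lemma le_iterate_insSum_size {k : ℕ} (m : ℕ) : ∀ s : RowState k,
    k ^ m * size k s ≤ insSum^[m] (size k) s := by
  induction m with
  | zero => simp
  | succ m ih =>
    intro s
    rw [Function.iterate_succ_apply', insSum]
    calc k ^ (m + 1) * size k s = ∑ b : Fin k, k ^ m * size k s := by simp; ring
      _ ≤ _ := Finset.sum_le_sum fun b _ =>
          (Nat.mul_le_mul_left _ (size_le_size_ins k b s)).trans (ih _)

lemma totalLNDS_zero (k : ℕ) : totalLNDS k 0 = 0 := size_empty k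

lemma totalLNDS_add_le (k a b : ℕ) :
    totalLNDS k (a + b) ≤ k ^ a * totalLNDS k b + k ^ b * totalLNDS k a := by
  unfold totalLNDS
  rw [Function.iterate_add_apply]
  refine (iterate_insSum_le_iterate_insSum a
    (ψ := fun s => insSum^[b] (size k) (empty k) + k ^ b * size k s) (fun s => ?_) _).trans ?_
  · refine iterate_insSum_size_le b fun j => ?_
    rw [cum_empty, zero_add]
    exact cum_le_size k s j
  · rw [← sum_insWord (fun s => insSum^[b] (size k) (empty k) + k ^ b * size k s),
      Finset.sum_add_distrib, ← Finset.mul_sum, sum_insWord]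
    simp

lemma le_totalLNDS_add (k a b : ℕ) : k ^ b * totalLNDS k a ≤ totalLNDS k (a + b) := by
  unfold totalLNDS
  rw [Function.iterate_add_apply, ← sum_insWord, ← sum_insWord, Finset.mul_sum]
  exact Finset.sum_le_sum fun u _ => le_iterate_insSum_size b _

end RowState

namespace RowState

open scoped ENNReal

/-- Sum of a function of the row against the product-geometric weight of ratio `r`. -/
noncomputable def geomSum {k : ℕ} (r : ℝ≥0∞) (φ : RowState k → ℝ≥0∞) : ℝ≥0∞ :=
  ∑' s, r ^ size k s * φ s

lemma geomSum_succ {k : ℕ} (r : ℝ≥0∞) (φ : RowState (k + 1) → ℝ≥0∞) :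
    geomSum r φ = ∑' a : ℕ, r ^ a * geomSum r fun s : RowState k => φ (a, s) := by
  unfold geomSum
  rw [ENNReal.tsum_prod']
  refine tsum_congr fun a => ?_
  rw [← ENNReal.tsum_mul_left]
  refine tsum_congr fun s => ?_
  simp [size, pow_add, mul_assoc]

lemma geomSum_add {k : ℕ} (r : ℝ≥0∞) (φ ψ : RowState k → ℝ≥0∞) :
    geomSum r (fun s => φ s + ψ s) = geomSum r φ + geomSum r ψ := by
  unfold geomSum
  rw [← ENNReal.tsum_add]
  exact tsum_congr fun s => mul_add _ _ _

lemma geomSum_const_mul {k : ℕ} (r c : ℝ≥0∞) (φ : RowState k → ℝ≥0∞) :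
    geomSum r (fun s => c * φ s) = c * geomSum r φ := by
  unfold geomSum
  rw [← ENNReal.tsum_mul_left]
  exact tsum_congr fun s => by ring

lemma geomSum_mono {k : ℕ} (r : ℝ≥0∞) {φ ψ : RowState k → ℝ≥0∞} (h : ∀ s, φ s ≤ ψ s) :
    geomSum r φ ≤ geomSum r ψ :=
  ENNReal.tsum_le_tsum fun s => mul_le_mul_right (h s) _

/-- Product-geometric weights are stationary for row insertion. -/
lemma geomSum_balance {r α : ℝ≥0∞} (h : α * r = 1) : ∀ {k : ℕ} (φ : RowState k → ℝ≥0∞),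
    α * geomSum r (fun s => φ (bump k s)) + geomSum r (insSum φ) = (α + k) * geomSum r φ
  | 0, φ => by
    have : geomSum r (insSum φ) = 0 := by simp [geomSum, insSum]
    simp [this, bump]
  | k + 1, φ => by
    have ih := fun a : ℕ => geomSum_balance h fun s : RowState k => φ (a, s)
    have hA : geomSum r (fun s => φ (bump (k + 1) s)) =
        geomSum r (fun s : RowState k => φ (0, bump k s)) +
          ∑' a : ℕ, r ^ (a + 1) * geomSum r fun s : RowState k => φ (a, s) := by
      rw [geomSum_succ, tsum_eq_zero_add' ENNReal.summable]
      simp [bump]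
    have hB : geomSum r (insSum φ) =
        ∑' a : ℕ, (r ^ a * geomSum r (fun s : RowState k => φ (a + 1, bump k s)) +
          r ^ a * geomSum r (insSum fun s : RowState k => φ (a, s))) := by
      rw [geomSum_succ]
      refine tsum_congr fun a => ?_
      rw [← mul_add, ← geomSum_add]
      congr 2
      funext s
      simp [insSum, Fin.sum_univ_succ, ins]
    have hC : α * geomSum r (fun s : RowState k => φ (0, bump k s)) +
        ∑' a : ℕ, r ^ a * geomSum r (fun s : RowState k => φ (a + 1, bump k s)) =
        ∑' a : ℕ, α * (r ^ a * geomSum r (fun s : RowState k => φ (a, bump k s))) := by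
      rw [tsum_eq_zero_add' (f := fun a : ℕ => α * (r ^ a * geomSum r
        (fun s : RowState k => φ (a, bump k s)))) ENNReal.summable]
      congr 1
      · simp
      · refine tsum_congr fun a => ?_
        rw [← mul_assoc, pow_succ', ← mul_assoc, h, one_mul]
    have hD : α * ∑' a : ℕ, r ^ (a + 1) * geomSum r (fun s : RowState k => φ (a, s)) =
        ∑' a : ℕ, r ^ a * geomSum r (fun s : RowState k => φ (a, s)) := by
      rw [← ENNReal.tsum_mul_left]
      refine tsum_congr fun a => ?_
      rw [← mul_assoc, pow_succ', ← mul_assoc, h, one_mul]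
    have hE : ∑' a : ℕ, α * (r ^ a * geomSum r (fun s : RowState k => φ (a, bump k s))) +
        ∑' a : ℕ, r ^ a * geomSum r (insSum fun s : RowState k => φ (a, s)) =
        (α + k) * ∑' a : ℕ, r ^ a * geomSum r (fun s : RowState k => φ (a, s)) := by
      rw [← ENNReal.tsum_add, ← ENNReal.tsum_mul_left]
      refine tsum_congr fun a => ?_
      rw [mul_left_comm, ← mul_add, ih, mul_left_comm]
    rw [hA, hB, ENNReal.tsum_add, mul_add, hD, geomSum_succ r φ, Nat.cast_succ, ← add_assoc α,
      add_mul, ← hE, ← hC]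
    ring

lemma geomSum_one (r : ℝ≥0∞) (hr : r < 1) : ∀ k : ℕ,
    geomSum r (fun _ : RowState k => 1) = ((1 - r)⁻¹) ^ k
  | 0 => by simp [geomSum, size]
  | k + 1 => by
    rw [geomSum_succ]
    simp_rw [geomSum_one r hr k]
    rw [ENNReal.tsum_mul_right, ENNReal.tsum_geometric, pow_succ']

lemma tsum_mul_geometric (r : ℝ≥0∞) : ∑' a : ℕ, r ^ a * (a : ℝ≥0∞) = r * (1 - r)⁻¹ * (1 - r)⁻¹ := by
  have h : ∀ a : ℕ, (a : ℝ≥0∞) = ∑' b : ℕ, if b < a then 1 else 0 := fun a => by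
    rw [tsum_eq_sum (s := Finset.range a) (by intro b hb; simpa using hb)]
    rw [Finset.sum_congr rfl fun b hb => if_pos (Finset.mem_range.1 hb)]
    simp
  calc ∑' a : ℕ, r ^ a * (a : ℝ≥0∞) = ∑' a : ℕ, ∑' b : ℕ, r ^ a * (if b < a then 1 else 0) := by
        refine tsum_congr fun a => ?_
        rw [ENNReal.tsum_mul_left, ← h]
    _ = ∑' b : ℕ, ∑' a : ℕ, r ^ a * (if b < a then 1 else 0) := ENNReal.tsum_comm
    _ = ∑' b : ℕ, r ^ (b + 1) * (1 - r)⁻¹ := by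
        refine tsum_congr fun b => ?_
        rw [← ENNReal.summable.sum_add_tsum_nat_add' (k := b + 1),
          Finset.sum_eq_zero, zero_add, ← ENNReal.tsum_geometric, ← ENNReal.tsum_mul_left]
        · refine tsum_congr fun a => ?_
          rw [if_pos (by omega)]
          ring
        · intro a ha
          rw [if_neg (by simp at ha; omega), mul_zero]
    _ = _ := by
        rw [ENNReal.tsum_mul_right]
        simp_rw [pow_succ']
        rw [ENNReal.tsum_mul_left, ENNReal.tsum_geometric]

lemma geomSum_size (r : ℝ≥0∞) (hr : r < 1) : ∀ k : ℕ,
    geomSum r (fun s : RowState k => (size k s : ℝ≥0∞)) =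
      k * (r * (1 - r)⁻¹) * ((1 - r)⁻¹) ^ k
  | 0 => by simp [geomSum, size]
  | k + 1 => by
    rw [geomSum_succ]
    have : ∀ a : ℕ, r ^ a * geomSum r (fun s : RowState k => (size (k + 1) (a, s) : ℝ≥0∞)) =
        r ^ a * a * ((1 - r)⁻¹) ^ k + r ^ a * (k * (r * (1 - r)⁻¹) * ((1 - r)⁻¹) ^ k) := by
      intro a
      rw [← geomSum_size r hr k, mul_assoc, ← mul_add, ← geomSum_one r hr,
        ← geomSum_const_mul r (a : ℝ≥0∞), ← geomSum_add]
      simp [size]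
    simp_rw [this]
    rw [ENNReal.tsum_add, ENNReal.tsum_mul_right, ENNReal.tsum_mul_right, tsum_mul_geometric,
      ENNReal.tsum_geometric]
    push_cast
    ring

lemma geomSum_iterate_insSum_succ_le {r α : ℝ≥0∞} (h : α * r = 1) (hα : α ≠ ∞) (k m : ℕ)
    (hfin : geomSum r (fun s : RowState k => ((insSum^[m] (size k) s : ℕ) : ℝ≥0∞)) ≠ ∞) :
    geomSum r (fun s : RowState k => ((insSum^[m + 1] (size k) s : ℕ) : ℝ≥0∞)) ≤
      k * geomSum r (fun s : RowState k => ((insSum^[m] (size k) s : ℕ) : ℝ≥0∞)) +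
        α * (k ^ m * geomSum r (fun _ : RowState k => 1)) := by
  set U := geomSum r (fun s : RowState k => ((insSum^[m] (size k) s : ℕ) : ℝ≥0∞)) with hU
  have hb := geomSum_balance h fun s : RowState k => ((insSum^[m] (size k) s : ℕ) : ℝ≥0∞)
  have h1 : U ≤ geomSum r (fun s : RowState k => ((insSum^[m] (size k) (bump k s) : ℕ) : ℝ≥0∞)) +
      k ^ m * geomSum r (fun _ : RowState k => 1) := by
    rw [← geomSum_const_mul, ← geomSum_add]
    refine geomSum_mono r fun s => ?_
    have := iterate_insSum_size_le (c := 1) m (s := s) (s' := bump k s)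
      (fun j => by rw [cum_bump]; omega)
    exact_mod_cast this
  have h2 : geomSum r (fun s : RowState k => ((insSum^[m + 1] (size k) s : ℕ) : ℝ≥0∞)) =
      geomSum r (insSum fun s : RowState k => ((insSum^[m] (size k) s : ℕ) : ℝ≥0∞)) := by
    congr 1
    funext s
    rw [Function.iterate_succ_apply', insSum, insSum]
    push_cast
    rfl
  rw [h2]
  have hfin' : α * U ≠ ∞ := ENNReal.mul_ne_top hα hfin
  refine (ENNReal.add_le_add_iff_left hfin').1 ?_
  calc _ ≤ α * (geomSum r (fun s : RowState k => ((insSum^[m] (size k) (bump k s) : ℕ) : ℝ≥0∞)) +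
      k ^ m * geomSum r (fun _ : RowState k => 1)) +
        geomSum r (insSum fun s : RowState k => ((insSum^[m] (size k) s : ℕ) : ℝ≥0∞)) := by gcongr
    _ = (α + k) * U + α * (k ^ m * geomSum r (fun _ : RowState k => 1)) := by
        rw [← hb]; ring
    _ = _ := by ring

lemma totalLNDS_le (k m : ℕ) (a : ℝ) (ha : 1 < a) :
    (k : ℝ) * totalLNDS k m ≤ (k : ℝ) ^ m * (k * (k / (a - 1)) + m * a) := by
  set r : ℝ≥0∞ := ENNReal.ofReal a⁻¹ with hr
  set α : ℝ≥0∞ := ENNReal.ofReal a with hα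
  have h : α * r = 1 := by
    rw [hr, hα, ← ENNReal.ofReal_mul (by linarith), mul_inv_cancel₀ (by linarith)]; simp
  have hr1 : r < 1 := by
    rw [hr, ← ENNReal.ofReal_one]
    exact (ENNReal.ofReal_lt_ofReal_iff one_pos).2 (inv_lt_one_of_one_lt₀ ha)
  have hgeo : (1 - r)⁻¹ = ENNReal.ofReal ((1 - a⁻¹)⁻¹) := by
    rw [hr, ← ENNReal.ofReal_one, ← ENNReal.ofReal_sub _ (by positivity),
      ENNReal.ofReal_inv_of_pos]
    have := inv_lt_one_of_one_lt₀ ha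
    linarith
  set Z := geomSum r (fun _ : RowState k => 1) with hZ
  have hZ1 := geomSum_one r hr1 k
  have hpos : 0 < (1 - a⁻¹)⁻¹ := by
    have := inv_lt_one_of_one_lt₀ ha
    exact inv_pos.2 (by linarith)
  have hZtop : Z ≠ ∞ := by
    rw [hZ, hZ1, hgeo]; exact ENNReal.pow_ne_top ENNReal.ofReal_ne_top
  have hZ0 : Z ≠ 0 := by
    rw [hZ, hZ1, hgeo]
    exact pow_ne_zero _ (by simpa using hpos)
  have key : ∀ m : ℕ, (k : ℝ≥0∞) * geomSum r (fun s : RowState k => ((insSum^[m] (size k) s : ℕ) : ℝ≥0∞)) ≤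
      k ^ m * Z * (k * (k * ENNReal.ofReal (1 / (a - 1))) + m * α) ∧
      geomSum r (fun s : RowState k => ((insSum^[m] (size k) s : ℕ) : ℝ≥0∞)) ≠ ∞ := by
    intro m
    induction m with
    | zero =>
      have h0 : r * (1 - r)⁻¹ = ENNReal.ofReal (1 / (a - 1)) := by
        rw [hgeo, hr, ← ENNReal.ofReal_mul (by positivity)]
        congr 1
        have : a - 1 ≠ 0 := by linarith
        field_simp
      simp only [Function.iterate_zero, id]
      rw [geomSum_size r hr1, h0, hZ, hZ1]
      constructor
      · apply le_of_eq; simp; ring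
      · rw [← hZ1]
        exact ENNReal.mul_ne_top (ENNReal.mul_ne_top (by simp) ENNReal.ofReal_ne_top) hZtop
    | succ m ih =>
      have hs := geomSum_iterate_insSum_succ_le h ENNReal.ofReal_ne_top k m ih.2
      constructor
      · calc _ ≤ (k : ℝ≥0∞) * (k * geomSum r (fun s : RowState k => ((insSum^[m] (size k) s : ℕ) : ℝ≥0∞)) +
              α * (k ^ m * Z)) := by gcongr
          _ = k * (k * geomSum r (fun s : RowState k => ((insSum^[m] (size k) s : ℕ) : ℝ≥0∞))) +
              k ^ (m + 1) * Z * α := by ring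
          _ ≤ k * (k ^ m * Z * (k * (k * ENNReal.ofReal (1 / (a - 1))) + m * α)) +
              k ^ (m + 1) * Z * α :=
              add_le_add (mul_le_mul_right ih.1 _) le_rfl
          _ = _ := by push_cast; ring
      · refine ne_top_of_le_ne_top ?_ hs
        refine ENNReal.add_ne_top.2 ⟨ENNReal.mul_ne_top (by simp) ih.2, ?_⟩
        exact ENNReal.mul_ne_top ENNReal.ofReal_ne_top (ENNReal.mul_ne_top (by simp) hZtop)
  have hlow : Z * (totalLNDS k m : ℝ≥0∞) ≤
      geomSum r (fun s : RowState k => ((insSum^[m] (size k) s : ℕ) : ℝ≥0∞)) := by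
    rw [mul_comm, hZ, ← geomSum_const_mul]
    refine geomSum_mono r fun s => ?_
    have := iterate_insSum_size_le (c := 0) m (s := empty k) (s' := s)
      (fun j => by rw [cum_empty]; omega)
    rw [mul_one]
    exact_mod_cast this
  have hfinal : Z * ((k : ℝ≥0∞) * totalLNDS k m) ≤
      Z * (k ^ m * (k * (k * ENNReal.ofReal (1 / (a - 1))) + m * α)) := by
    calc _ = (k : ℝ≥0∞) * (Z * totalLNDS k m) := by ring
      _ ≤ _ := (mul_le_mul_right hlow _).trans (key m).1
      _ = _ := by ring
  rw [ENNReal.mul_le_mul_iff_right hZ0 hZtop] at hfinal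
  have ha1 : 0 < a - 1 := by linarith
  have := ENNReal.toReal_mono (by
    refine ENNReal.mul_ne_top (by simp) (ENNReal.add_ne_top.2 ⟨?_, ?_⟩)
    · exact ENNReal.mul_ne_top (by simp) (ENNReal.mul_ne_top (by simp) ENNReal.ofReal_ne_top)
    · exact ENNReal.mul_ne_top (by simp) ENNReal.ofReal_ne_top) hfinal
  rw [ENNReal.toReal_mul, ENNReal.toReal_mul, ENNReal.toReal_add, ENNReal.toReal_mul,
    ENNReal.toReal_mul, ENNReal.toReal_mul, ENNReal.toReal_ofReal (by positivity),
    ENNReal.toReal_ofReal (by linarith)] at this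
  · simpa [div_eq_mul_inv] using this
  · exact ENNReal.mul_ne_top (by simp) (ENNReal.mul_ne_top (by simp) ENNReal.ofReal_ne_top)
  · exact ENNReal.mul_ne_top (by simp) ENNReal.ofReal_ne_top

lemma expLNDS_le {k : ℕ} (hk : 1 ≤ k) (m : ℕ) : expLNDS k m ≤ m / k + 2 * √m := by
  have hk' : (0 : ℝ) < k := by exact_mod_cast hk
  rcases Nat.eq_zero_or_pos m with rfl | hm
  · simp [expLNDS_eq, totalLNDS_zero]
  have hm' : (0 : ℝ) < √m := Real.sqrt_pos.2 (by exact_mod_cast hm)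
  have hsq : √(m : ℝ) * √m = m := Real.mul_self_sqrt (by positivity)
  have h := totalLNDS_le k m (1 + k / √m) (by have := div_pos hk' hm'; linarith)
  rw [expLNDS_eq, div_le_iff₀ (by positivity)]
  have h2 : (k : ℝ) * (k / (1 + k / √m - 1)) + m * (1 + k / √m) = k * (m / k + 2 * √m) := by
    rw [show (1 : ℝ) + k / √m - 1 = k / √m by ring]
    have hdiv : (m : ℝ) / √m = √m := by rw [div_eq_iff hm'.ne', hsq]
    rw [div_div_cancel₀ hk'.ne', mul_add, mul_one, mul_div_left_comm, hdiv]
    field_simp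
    ring
  rw [h2] at h
  have : (k : ℝ) * totalLNDS k m ≤ k * ((m / k + 2 * √m) * k ^ m) := by linarith
  exact le_of_mul_le_mul_left this hk'

end RowState

open Polynomial in
/-- Leibniz rule for the derivative of a determinant of polynomials. -/
lemma Matrix.derivative_det {ι R : Type*} [Fintype ι] [DecidableEq ι] [CommRing R]
    (M : Matrix ι ι R[X]) :
    derivative M.det = ∑ b, (M.updateRow b fun j => derivative (M b j)).det := by
  simp_rw [← Matrix.det_transpose M, ← Matrix.det_transpose (Matrix.updateRow _ _ _),
    Matrix.det_apply]
  rw [Finset.sum_comm, map_sum]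
  refine Finset.sum_congr rfl fun σ _ => ?_
  rw [← Finset.smul_sum, Units.smul_def, Units.smul_def, map_zsmul, derivative_prod_finset]
  congr 1
  refine Finset.sum_congr rfl fun b _ => ?_
  rw [← Finset.prod_erase_mul Finset.univ _ (Finset.mem_univ b)]
  congr 1
  · refine Finset.prod_congr rfl fun i hi => ?_
    simp [Matrix.transpose_apply, Matrix.updateRow_ne (Finset.ne_of_mem_erase hi)]
  · simp [Matrix.transpose_apply]

/-- The `(j + 1)`-fold summation `∑_{z = 0}^{y} (y - z).choose j • g z`. -/
noncomputable def binomSum {V : Type*} [AddCommGroup V] (j : ℕ) (g : ℤ → V) (y : ℤ) : V :=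
  ∑ z ∈ Finset.range (y + 1).toNat, (y.toNat - z).choose j • g z

section binomSum

variable {V : Type*} [AddCommGroup V]

lemma binomSum_natCast (j : ℕ) (g : ℤ → V) (n : ℕ) :
    binomSum j g n = ∑ z ∈ Finset.range (n + 1), (n - z).choose j • g z := by
  have : ((n : ℤ) + 1).toNat = n + 1 := by omega
  simp [binomSum, this]

lemma binomSum_of_neg (j : ℕ) (g : ℤ → V) {y : ℤ} (hy : y < 0) : binomSum j g y = 0 := by
  have : (y + 1).toNat = 0 := by omega
  simp [binomSum, this]

lemma binomSum_sub_one (j : ℕ) {g : ℤ → V} (hg : ∀ z < 0, g z = 0) (y : ℤ) :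
    binomSum j g (y - 1) = binomSum j (fun z => g (z - 1)) y := by
  rcases lt_or_ge y 1 with h | h
  · rw [binomSum_of_neg _ _ (by omega)]
    rcases lt_or_ge y 0 with h' | h'
    · rw [binomSum_of_neg _ _ (by omega)]
    · have : y = 0 := by omega
      subst this
      simp [binomSum, hg (-1) (by omega)]
  · obtain ⟨n, rfl⟩ : ∃ n : ℕ, y = ((n + 1 : ℕ) : ℤ) := ⟨(y - 1).toNat, by omega⟩
    rw [binomSum_natCast, Finset.sum_range_succ', show (((n + 1 : ℕ) : ℤ) - 1) = n by push_cast; ring,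
      binomSum_natCast]
    simp only [Nat.cast_zero, zero_sub, hg (-1) (by omega), smul_zero, add_zero]
    refine Finset.sum_congr rfl fun z hz => ?_
    rw [Nat.add_sub_add_right]
    congr 2
    push_cast; ring

end binomSum

lemma fwdDiff_iterate_succ_apply {V : Type*} [AddCommGroup V] (f : ℤ → V) (i : ℕ) (y : ℤ) :
    (fwdDiff 1)^[i + 1] f y = (fwdDiff 1)^[i] f (y + 1) - (fwdDiff 1)^[i] f y := by
  rw [Function.iterate_succ_apply', fwdDiff]

namespace RowState

open Polynomial

/-- The polynomial `X ^ z / z!`, extended by zero to negative `z`. -/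
noncomputable def expMonomial (z : ℤ) : ℝ[X] :=
  if z < 0 then 0 else monomial z.toNat (1 / (z.toNat.factorial : ℝ))

lemma expMonomial_of_neg {z : ℤ} (hz : z < 0) : expMonomial z = 0 := if_pos hz

lemma expMonomial_natCast (z : ℕ) : expMonomial z = monomial z (1 / (z.factorial : ℝ)) := by
  simp [expMonomial]

lemma derivative_expMonomial (z : ℤ) : derivative (expMonomial z) = expMonomial (z - 1) := by
  rcases lt_or_ge z 1 with h | h
  · rw [expMonomial_of_neg (z := z - 1) (by omega)]
    rcases lt_or_ge z 0 with h' | h'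
    · rw [expMonomial_of_neg h', map_zero]
    · have : z = 0 := by omega
      subst this
      simp [expMonomial]
  · obtain ⟨n, rfl⟩ : ∃ n : ℕ, z = ((n + 1 : ℕ) : ℤ) := ⟨(z - 1).toNat, by omega⟩
    rw [show (((n + 1 : ℕ) : ℤ) - 1) = n by push_cast; ring, expMonomial_natCast,
      expMonomial_natCast, derivative_monomial, Nat.factorial_succ]
    congr 1
    push_cast
    have : (n : ℝ) + 1 ≠ 0 := by positivity
    have : (n.factorial : ℝ) ≠ 0 := by positivity
    simp
    field_simp

/-- Entry of the determinant counting words by their row profile. -/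
noncomputable def profileEntry (i j : ℕ) (y : ℤ) : ℝ[X] :=
  (fwdDiff 1)^[i] (binomSum j expMonomial) y

lemma profileEntry_succ (i j : ℕ) (y : ℤ) :
    profileEntry (i + 1) j y = profileEntry i j (y + 1) - profileEntry i j y :=
  fwdDiff_iterate_succ_apply _ _ _

lemma derivative_profileEntry (i j : ℕ) (y : ℤ) :
    derivative (profileEntry i j y) = profileEntry i j (y - 1) := by
  induction i generalizing y with
  | zero =>
    simp only [profileEntry, Function.iterate_zero, id]
    rw [binomSum_sub_one j (fun z hz => expMonomial_of_neg hz)]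
    simp_rw [← derivative_expMonomial]
    simp [binomSum]
  | succ i ih =>
    rw [profileEntry_succ, map_sub, ih, ih, profileEntry_succ]
    congr 2
    ring

lemma coeff_zero_profileEntry (i j : ℕ) {y : ℤ} (hy : 0 ≤ y) :
    (profileEntry i j y).coeff 0 = if i ≤ j then (y.toNat.choose (j - i) : ℝ) else 0 := by
  induction i generalizing y with
  | zero =>
    lift y to ℕ using hy
    simp only [profileEntry, Function.iterate_zero, id, binomSum_natCast, finsetSum_coeff]
    rw [Finset.sum_eq_single 0]
    · simp [expMonomial]
    · intro z _ hz
      simp [expMonomial_natCast, coeff_monomial, hz]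
    · simp
  | succ i ih =>
    rw [profileEntry_succ, coeff_sub, ih (by omega), ih hy]
    lift y to ℕ using hy
    have : ((y : ℤ) + 1).toNat = y + 1 := by omega
    rw [this, Int.toNat_natCast]
    rcases lt_trichotomy i j with h | rfl | h
    · rw [if_pos h.le, if_pos h.le, if_pos (Nat.succ_le_of_lt h)]
      obtain ⟨d, rfl⟩ : ∃ d, j = i + 1 + d := ⟨j - i - 1, by omega⟩
      rw [show i + 1 + d - i = d + 1 by omega, Nat.add_sub_cancel_left, Nat.choose_succ_succ]
      push_cast; ring
    · simp
    · rw [if_neg (by omega), if_neg (by omega), if_neg (by omega), sub_zero]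

/-- Determinant whose coefficients count the words with a row profile bounded by `y`. -/
noncomputable def profileDet {k : ℕ} (y : Fin k → ℤ) : ℝ[X] :=
  Matrix.det (Matrix.of fun i j : Fin k => profileEntry i j (y i))

lemma derivative_profileDet {k : ℕ} (y : Fin k → ℤ) :
    derivative (profileDet y) = ∑ b, profileDet (Function.update y b (y b - 1)) := by
  unfold profileDet
  rw [Matrix.derivative_det]
  refine Finset.sum_congr rfl fun b _ => ?_
  congr 1
  ext1 i j
  rcases eq_or_ne i b with rfl | h
  · simp [derivative_profileEntry]
  · simp [Matrix.updateRow_ne h, Function.update_of_ne h]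

lemma profileDet_update {k : ℕ} (y : Fin k → ℤ) {c c' : Fin k} (hc : (c' : ℕ) = c + 1)
    (h : y c = y c' + 1) : profileDet y = profileDet (Function.update y c (y c')) := by
  unfold profileDet
  have hne : c ≠ c' := by rintro rfl; omega
  rw [← Matrix.det_updateRow_add_self
    (Matrix.of fun i j : Fin k => profileEntry i j (Function.update y c (y c') i)) hne]
  congr 1
  ext1 i j
  rcases eq_or_ne i c with rfl | hi
  · simp [h, hc, profileEntry_succ, hne.symm]
  · simp [Matrix.updateRow_ne hi, Function.update_of_ne hi]

/-- The profile bound that a word must satisfy for its extension by the letter `b` to have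
profile bounded by `y`. -/
def lowerProfile {k : ℕ} (y : Fin k → ℤ) (b : Fin k) (i : Fin k) : ℤ :=
  if i ≤ b then min (y i) (y b - 1) else y i

lemma profileDet_lowerProfile {k : ℕ} {y : Fin k → ℤ} (hy : Monotone y) (b : Fin k) :
    profileDet (lowerProfile y b) = profileDet (Function.update y b (y b - 1)) := by
  have key : ∀ d : ℕ, d ≤ b → profileDet (fun i : Fin k =>
      if (b : ℕ) - d ≤ i ∧ i ≤ b then min (y i) (y b - 1) else y i) =
        profileDet (Function.update y b (y b - 1)) := by
    intro d
    induction d with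
    | zero =>
      intro _
      congr 1
      funext i
      rcases eq_or_ne i b with rfl | hi
      · simp
      · rw [Function.update_of_ne hi, if_neg]
        rintro ⟨h1, h2⟩
        exact hi (Fin.ext (by have := Fin.le_def.1 h2; omega))
    | succ d ih =>
      intro hd
      rw [← ih (by omega)]
      set c : Fin k := ⟨b - (d + 1), by omega⟩ with hc
      set c' : Fin k := ⟨b - d, by omega⟩ with hc'
      have hcb : c ≤ b := by rw [Fin.le_def]; simp [hc]
      have hc'b : c' ≤ b := by rw [Fin.le_def]; simp [hc']
      have hcc' : c ≤ c' := by rw [Fin.le_def]; simp [hc, hc']; omega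
      set z : Fin k → ℤ := fun i =>
        if (b : ℕ) - d ≤ i ∧ i ≤ b then min (y i) (y b - 1) else y i with hz
      have hzc : z c = y c := if_neg (by simp [hc]; omega)
      have hzc' : z c' = min (y c') (y b - 1) := if_pos ⟨le_rfl, hc'b⟩
      have hyc := hy hcb
      have hyc' := hy hc'b
      have hycc' := hy hcc'
      have hnew : (fun i : Fin k => if (b : ℕ) - (d + 1) ≤ i ∧ i ≤ b then min (y i) (y b - 1)
          else y i) = Function.update z c (min (y c) (y b - 1)) := by
        funext i
        rcases eq_or_ne i c with rfl | hi
        · rw [Function.update_self, if_pos ⟨le_rfl, hcb⟩]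
        · rw [Function.update_of_ne hi, hz]
          have : ((b : ℕ) - (d + 1) ≤ i ∧ i ≤ b) ↔ ((b : ℕ) - d ≤ i ∧ i ≤ b) := by
            have : (i : ℕ) ≠ b - (d + 1) := fun h => hi (Fin.ext h)
            rw [Fin.le_def]
            omega
          simp only [this]
      rw [hnew]
      rcases lt_or_ge (y c) (y b) with hlt | hge
      · rw [min_eq_left (by omega), ← hzc, Function.update_eq_self]
      · have e1 : min (y c) (y b - 1) = z c' := by rw [hzc']; omega
        rw [e1, ← profileDet_update z (c := c) (c' := c') (by simp [hc, hc']; omega)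
          (by rw [hzc, hzc']; omega)]
  rw [← key b le_rfl]
  congr 1
  funext i
  simp [lowerProfile]

lemma lowerProfile_monotone {k : ℕ} {y : Fin k → ℤ} (hy : Monotone y) (b : Fin k) :
    Monotone (lowerProfile y b) := by
  intro i j hij
  have h1 := hy hij
  unfold lowerProfile
  split_ifs with h2 h3 h3
  · omega
  · omega
  · exact absurd (hij.trans h3) h2
  · exact h1

lemma cum_ins_le_iff {k : ℕ} {y : Fin k → ℤ} (hy : Monotone y) (b : Fin k) (s : RowState k) :
    (∀ j, (cum k (ins k b s) j : ℤ) ≤ y j) ↔ ∀ j, (cum k s j : ℤ) ≤ lowerProfile y b j := by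
  have hb : cum k (ins k b s) b = cum k s b + 1 := by rw [cum_ins]; simp
  constructor
  · intro h j
    have h1 := h j
    have h2 := h b
    rw [hb] at h2
    rw [cum_ins] at h1
    unfold lowerProfile
    split_ifs with hj
    · have := cum_monotone k s hj
      split_ifs at h1 <;> push_cast at * <;> omega
    · rw [if_neg (by omega)] at h1
      push_cast at h1
      omega
  · intro h j
    have h1 := h j
    have h2 := h b
    simp only [lowerProfile, le_refl, if_true] at h1 h2
    rw [cum_ins]
    split_ifs with hj
    · rw [if_pos hj.le] at h1; omega
    · have := hy (not_lt.1 hj)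
      split_ifs at h1 <;> push_cast <;> omega

lemma profileDet_eq_zero {k : ℕ} {y : Fin k → ℤ} (hy : Monotone y) {i : Fin k} (hi : y i = -1) :
    profileDet y = 0 := by
  refine Matrix.det_eq_zero_of_row_eq_zero ⟨0, i.pos⟩ fun j => ?_
  have : y ⟨0, i.pos⟩ ≤ y i := hy (by rw [Fin.le_def]; simp)
  simp only [Matrix.of_apply, profileEntry, Function.iterate_zero, id]
  exact binomSum_of_neg _ _ (by omega)

lemma coeff_zero_profileDet {k : ℕ} {y : Fin k → ℤ} (hy : ∀ i, 0 ≤ y i) :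
    (profileDet y).coeff 0 = 1 := by
  rw [← constantCoeff_apply, profileDet, RingHom.map_det, Matrix.det_of_isUpperTriangular]
  · refine Finset.prod_eq_one fun i _ => ?_
    simp [coeff_zero_profileEntry _ _ (hy i)]
  · intro i j hij
    have : ¬ (i : ℕ) ≤ j := not_le.2 hij
    simp [coeff_zero_profileEntry _ _ (hy i), this]

open Classical in
lemma iterate_insSum_of_eq_neg_one {k : ℕ} (m : ℕ) {y : Fin k → ℤ} {i : Fin k} (hi : y i = -1) :
    insSum^[m] (fun s : RowState k => if ∀ j, (cum k s j : ℤ) ≤ y j then 1 else 0)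
      (empty k) = (0 : ℕ) := by
  have : (fun s : RowState k => if ∀ j, (cum k s j : ℤ) ≤ y j then 1 else 0) =
      fun _ => (0 : ℕ) := by
    funext s
    exact if_neg fun h => by have := h i; omega
  rw [this, iterate_insSum_const, mul_zero]

open Classical in
lemma factorial_mul_coeff_profileDet {k : ℕ} (m : ℕ) : ∀ {y : Fin k → ℤ}, Monotone y →
    (∀ i, -1 ≤ y i) → (m.factorial : ℝ) * (profileDet y).coeff m =
      (insSum^[m] (fun s : RowState k => if ∀ j, (cum k s j : ℤ) ≤ y j then 1 else 0)
        (empty k) : ℕ) := by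
  induction m with
  | zero =>
    intro y hy hy1
    by_cases hneg : ∃ i, y i = -1
    · obtain ⟨i, hi⟩ := hneg
      rw [profileDet_eq_zero hy hi, iterate_insSum_of_eq_neg_one _ hi]
      simp
    · push Not at hneg
      have hy0 : ∀ i, 0 ≤ y i := fun i => by have := hneg i; have := hy1 i; omega
      simp [coeff_zero_profileDet hy0, cum_empty, hy0]
  | succ m ih =>
    intro y hy hy1
    by_cases hneg : ∃ i, y i = -1
    · obtain ⟨i, hi⟩ := hneg
      rw [profileDet_eq_zero hy hi, iterate_insSum_of_eq_neg_one _ hi]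
      simp
    · push Not at hneg
      have hy0 : ∀ i, 0 ≤ y i := fun i => by have := hneg i; have := hy1 i; omega
      have hlin : insSum (fun s : RowState k => if ∀ j, (cum k s j : ℤ) ≤ y j then 1 else 0) =
          fun s => ∑ b, if ∀ j, (cum k s j : ℤ) ≤ lowerProfile y b j then 1 else 0 := by
        funext s
        rw [insSum]
        refine Finset.sum_congr rfl fun b _ => ?_
        simp only [cum_ins_le_iff hy]
      rw [Function.iterate_succ_apply, hlin, ← sum_insWord, Finset.sum_comm]
      push_cast
      have hcoeff : ((m + 1).factorial : ℝ) * (profileDet y).coeff (m + 1) =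
          m.factorial * (derivative (profileDet y)).coeff m := by
        rw [coeff_derivative, Nat.factorial_succ]; push_cast; ring
      rw [hcoeff, derivative_profileDet, finsetSum_coeff, Finset.mul_sum]
      refine Finset.sum_congr rfl fun b _ => ?_
      rw [← profileDet_lowerProfile hy, ih (lowerProfile_monotone hy b), ← sum_insWord]
      · push_cast; rfl
      · intro i
        have := hy0 i
        have := hy0 b
        unfold lowerProfile
        split_ifs <;> omega

lemma hasSum_iterate_insSum_le {k : ℕ} (x : ℕ) (t : ℝ) :
    HasSum (fun m : ℕ => t ^ m / m.factorial *
      (insSum^[m] (fun s : RowState k => if size k s ≤ x then 1 else 0) (empty k) : ℕ))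
      ((profileDet fun _ : Fin k => (x : ℤ)).eval t) := by
  have hcoeff (m : ℕ) : t ^ m / m.factorial *
      (insSum^[m] (fun s : RowState k => if size k s ≤ x then 1 else 0) (empty k) : ℕ) =
      (profileDet fun _ : Fin k => (x : ℤ)).coeff m * t ^ m := by
    classical
    have h := factorial_mul_coeff_profileDet (k := k) m (y := fun _ => (x : ℤ)) monotone_const
      (fun _ => by omega)
    have hfun : (fun s : RowState k => if size k s ≤ x then 1 else 0) =
        fun s : RowState k => if ∀ j, (cum k s j : ℤ) ≤ (x : ℤ) then 1 else (0 : ℕ) := by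
      funext s
      have : size k s ≤ x ↔ ∀ j, (cum k s j : ℤ) ≤ (x : ℤ) := by
        constructor
        · intro h j
          have := cum_le_size k s j
          omega
        · intro h
          cases k with
          | zero => simp [size]
          | succ k => have := h (Fin.last k); rw [cum_last] at this; omega
      simp only [this]
    rw [hfun]
    convert congrArg (fun z => t ^ m / m.factorial * z) h.symm using 1
    have : (m.factorial : ℝ) ≠ 0 := by positivity
    field_simp
  simp_rw [hcoeff]
  rw [eval_eq_sum_range]
  refine hasSum_sum_of_ne_finset_zero fun m hm => ?_
  rw [coeff_eq_zero_of_natDegree_lt, zero_mul]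
  simpa using hm

end RowState

section

open Polynomial

lemma Matrix.det_linearMap_polynomial {R : Type*} [CommRing R] {k : ℕ}
    (B : Fin k → R[X] →ₗ[R] R) (q : Fin k → R[X]) (hq : ∀ j, (q j).natDegree ≤ j) :
    (Matrix.of fun i j => B i (q j)).det =
      (Matrix.of fun i j : Fin k => B i (X ^ (j : ℕ))).det * ∏ j, (q j).coeff j := by
  have hmul : (Matrix.of fun i j => B i (q j)) = (Matrix.of fun i j : Fin k => B i (X ^ (j : ℕ))) *
      Matrix.of fun l j : Fin k => (q j).coeff l := by
    ext i j
    rw [Matrix.mul_apply]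
    simp only [Matrix.of_apply]
    conv_lhs => rw [(q j).as_sum_range' k ((hq j).trans_lt j.2)]
    rw [map_sum, Finset.sum_range]
    refine Finset.sum_congr rfl fun l _ => ?_
    rw [← C_mul_X_pow_eq_monomial, ← smul_eq_C_mul, map_smul, smul_eq_mul, mul_comm]
  rw [hmul, Matrix.det_mul, Matrix.det_of_isUpperTriangular (M := Matrix.of fun l j : Fin k => (q j).coeff l)]
  · rfl
  · intro l j hlj
    exact coeff_eq_zero_of_natDegree_lt ((hq j).trans_lt hlj)

/-- Shifting the rows of a matrix of iterated differences does not change its determinant. -/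
lemma Matrix.det_fwdDiff_shift {R : Type*} [CommRing R] (K : ℕ) (f : Fin (K + 1) → ℤ → R) (x : ℤ) :
    (Matrix.of fun i j : Fin (K + 1) => (fwdDiff 1)^[i] (f j) x).det =
      (Matrix.of fun i j : Fin (K + 1) => (fwdDiff 1)^[i] (f j) (x + (K - i))).det := by
  have hmul : (Matrix.of fun i j : Fin (K + 1) => (fwdDiff 1)^[i] (f j) (x + (K - i))) =
      (Matrix.of fun i l : Fin (K + 1) =>
        if (i : ℕ) ≤ l then ((K - i).choose (l - i) : R) else 0) *
      Matrix.of fun i j : Fin (K + 1) => (fwdDiff 1)^[i] (f j) x := by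
    ext i j
    have hi : (i : ℕ) ≤ K := Nat.lt_succ_iff.1 i.2
    have hsum (g : ℕ → R) : ∑ l ∈ Finset.range (K + 1), g l =
        ∑ l ∈ Finset.range i, g l + ∑ l ∈ Finset.range (K - i + 1), g (i + l) := by
      rw [← Finset.sum_range_add, show (i : ℕ) + (K - i + 1) = K + 1 by omega]
    rw [Matrix.mul_apply]
    simp only [Matrix.of_apply]
    rw [Fin.sum_univ_eq_sum_range (fun l => (if (i : ℕ) ≤ l then ((K - i).choose (l - i) : R)
      else 0) * (fwdDiff 1)^[l] (f j) x), hsum, Finset.sum_eq_zero, zero_add]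
    · have h := shift_eq_sum_fwdDiff_iter 1 ((fwdDiff 1)^[i] (f j)) (K - i) x
      rw [nsmul_one, Nat.cast_sub hi] at h
      rw [h]
      refine Finset.sum_congr rfl fun l _ => ?_
      rw [if_pos (by omega), Nat.add_sub_cancel_left, nsmul_eq_mul, ← Function.iterate_add_apply,
        add_comm l]
    · intro l hl
      rw [if_neg (by simpa using hl), zero_mul]
  rw [hmul, Matrix.det_mul, Matrix.det_of_isUpperTriangular (M := Matrix.of fun i l : Fin (K + 1) =>
        if (i : ℕ) ≤ l then ((K - i).choose (l - i) : R) else 0)]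
  · simp
  · intro i l hil
    exact if_neg (not_le.2 hil)

/-- The monic Charlier polynomials. -/
noncomputable def charlier (t : ℝ) : ℕ → ℝ[X]
  | 0 => 1
  | n + 1 => X * (charlier t n).comp (X - 1) - C t * charlier t n

lemma charlier_monic_and_natDegree (t : ℝ) (n : ℕ) :
    (charlier t n).Monic ∧ (charlier t n).natDegree = n := by
  induction n with
  | zero => simp [charlier]
  | succ n ih =>
    have hX : (X - 1 : ℝ[X]).natDegree = 1 := by
      rw [← C_1]; exact natDegree_X_sub_C 1
    have hm : (X * (charlier t n).comp (X - 1)).Monic := by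
      refine monic_X.mul (ih.1.comp ?_ (by rw [hX]; exact one_ne_zero))
      rw [← C_1]; exact monic_X_sub_C 1
    have hd : (X * (charlier t n).comp (X - 1)).natDegree = n + 1 := by
      rw [monic_X.natDegree_mul']
      · rw [natDegree_comp, ih.2, hX, natDegree_X]; ring
      · intro h
        rw [h, mul_zero] at hm
        exact not_monic_zero hm
    have hlt : (C t * charlier t n).natDegree < (X * (charlier t n).comp (X - 1)).natDegree := by
      rw [hd]
      have := natDegree_C_mul_le t (charlier t n)
      omega
    refine ⟨hm.sub_of_left (degree_lt_degree hlt), ?_⟩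
    rw [charlier, natDegree_sub_eq_left_of_natDegree_lt hlt, hd]

lemma natDegree_charlier (t : ℝ) (n : ℕ) : (charlier t n).natDegree = n :=
  (charlier_monic_and_natDegree t n).2

lemma coeff_charlier (t : ℝ) (n : ℕ) : (charlier t n).coeff n = 1 := by
  have h := (charlier_monic_and_natDegree t n).1
  rwa [Monic, leadingCoeff, natDegree_charlier] at h

lemma exists_polynomial_choose_sub (N j : ℕ) : ∃ q : ℝ[X], q.natDegree ≤ j ∧
    q.coeff j = (-1) ^ j / j.factorial ∧ ∀ z ≤ N, q.eval (z : ℝ) = (N - z).choose j := by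
  induction j with
  | zero => exact ⟨1, by simp, by simp, by simp⟩
  | succ j ih =>
    obtain ⟨q, h1, h2, h3⟩ := ih
    have hl : (C ((N : ℝ) - j) - X : ℝ[X]).natDegree ≤ 1 := by compute_degree
    refine ⟨C (1 / ((j : ℝ) + 1)) * (q * (C ((N : ℝ) - j) - X)), ?_, ?_, ?_⟩
    · refine (natDegree_C_mul_le _ _).trans (natDegree_mul_le.trans ?_)
      omega
    · rw [coeff_C_mul, coeff_mul_add_eq_of_natDegree_le h1 hl, h2, Nat.factorial_succ]
      have : (j : ℝ) + 1 ≠ 0 := by positivity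
      have : (j.factorial : ℝ) ≠ 0 := by positivity
      simp [coeff_X]
      field_simp
      ring
    · intro z hz
      have h := Nat.choose_succ_right_eq (N - z) j
      have h' : ((N - z).choose (j + 1) : ℝ) * (j + 1) = (N - z).choose j * ((N : ℝ) - z - j) := by
        rcases lt_or_ge (N - z) j with hlt | hge
        · rw [Nat.choose_eq_zero_of_lt hlt, Nat.choose_eq_zero_of_lt (by omega)]; simp
        · rw [← Nat.cast_sub hz, ← Nat.cast_sub hge]
          exact_mod_cast h
      have : (j : ℝ) + 1 ≠ 0 := by positivity
      simp [h3 z hz]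
      field_simp
      linarith

namespace RowState

lemma fwdDiff_iterate_binomSum {V : Type*} [AddCommGroup V] {g : ℕ → ℤ → V}
    (hg : ∀ i, ∀ z < 0, g i z = 0) (hs : ∀ i z, g (i + 1) z = g i z - g i (z - 1)) (i j : ℕ)
    (y : ℤ) : (fwdDiff 1)^[i] (binomSum j (g 0)) (y - i) = binomSum j (g i) y := by
  induction i generalizing y with
  | zero => simp
  | succ i ih =>
    rw [fwdDiff_iterate_succ_apply]
    have h1 := ih y
    have h2 := ih (y - 1)
    rw [binomSum_sub_one j (hg i)] at h2
    rw [show y - ((i + 1 : ℕ) : ℤ) + 1 = y - i by push_cast; ring,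
      show y - ((i + 1 : ℕ) : ℤ) = y - 1 - i by push_cast; ring, h1, h2]
    simp only [binomSum, hs, smul_sub, Finset.sum_sub_distrib]

lemma eval_expMonomial_sub_one (t : ℝ) (z : ℤ) :
    t * (expMonomial (z - 1)).eval t = z * (expMonomial z).eval t := by
  rcases lt_or_ge z 1 with h | h
  · rw [expMonomial_of_neg (z := z - 1) (by omega)]
    rcases lt_or_ge z 0 with h' | h'
    · rw [expMonomial_of_neg h']; simp
    · have : z = 0 := by omega
      simp [this]
  · obtain ⟨n, rfl⟩ : ∃ n : ℕ, z = ((n + 1 : ℕ) : ℤ) := ⟨(z - 1).toNat, by omega⟩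
    rw [show (((n + 1 : ℕ) : ℤ) - 1) = n by push_cast; ring, expMonomial_natCast,
      expMonomial_natCast, Nat.factorial_succ]
    have : (n : ℝ) + 1 ≠ 0 := by positivity
    have : (n.factorial : ℝ) ≠ 0 := by positivity
    simp [eval_monomial]
    field_simp
    ring

lemma fwdDiff_iterate_binomSum_eval {t : ℝ} (ht : t ≠ 0) (i j : ℕ) (y : ℤ) :
    (-t) ^ i * (fwdDiff 1)^[i] (binomSum j fun z => (expMonomial z).eval t) (y - i) =
      binomSum j (fun z => (charlier t i).eval (z : ℝ) * (expMonomial z).eval t) y := by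
  have h := fwdDiff_iterate_binomSum (g := fun i z =>
    (1 / (-t) ^ i) * ((charlier t i).eval (z : ℝ) * (expMonomial z).eval t)) ?_ ?_ i j y
  · have h0 : (binomSum j fun z => (expMonomial z).eval t) = binomSum j fun z =>
        (1 / (-t) ^ 0) * ((charlier t 0).eval (z : ℝ) * (expMonomial z).eval t) := by
      simp [charlier]
    rw [h0, h]
    have hti : (-t) ^ i ≠ 0 := pow_ne_zero _ (neg_ne_zero.2 ht)
    rw [binomSum, binomSum, Finset.mul_sum]
    refine Finset.sum_congr rfl fun z _ => ?_
    simp only [nsmul_eq_mul]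
    field_simp
  · intro i z hz
    simp [expMonomial_of_neg hz]
  · intro i z
    have hti : (-t) ^ i ≠ 0 := pow_ne_zero _ (neg_ne_zero.2 ht)
    have h1 : (expMonomial (z - 1)).eval t = z * (expMonomial z).eval t / t := by
      rw [← eval_expMonomial_sub_one t]; field_simp
    simp only [h1, charlier, eval_sub, eval_mul, eval_X, eval_comp, eval_C, eval_one, pow_succ]
    push_cast
    field_simp
    ring

/-- The truncated Gram matrix of the Charlier polynomials. -/
lemma eval_profileDet_const {t : ℝ} (ht : t ≠ 0) (K x : ℕ) :
    (∏ i : Fin (K + 1), (t ^ (i : ℕ) * (i : ℕ).factorial)) *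
      (profileDet fun _ : Fin (K + 1) => (x : ℤ)).eval t =
    (Matrix.of fun i j : Fin (K + 1) => ∑ z ∈ Finset.range (x + K + 1),
      (charlier t i).eval (z : ℝ) * (charlier t j).eval (z : ℝ) * (t ^ z / z.factorial)).det := by
  choose q hq1 hq2 hq3 using fun j : Fin (K + 1) => exists_polynomial_choose_sub (x + K) j
  let B : Fin (K + 1) → ℝ[X] →ₗ[ℝ] ℝ := fun i => ∑ z ∈ Finset.range (x + K + 1),
    ((charlier t i).eval (z : ℝ) * (t ^ z / z.factorial)) • leval (z : ℝ)
  have hB (i : Fin (K + 1)) (f : ℝ[X]) : B i f = ∑ z ∈ Finset.range (x + K + 1),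
      (charlier t i).eval (z : ℝ) * (t ^ z / z.factorial) * f.eval (z : ℝ) := by
    simp [B, leval_apply]
  have hR : (Matrix.of fun i j : Fin (K + 1) => ∑ z ∈ Finset.range (x + K + 1),
      (charlier t i).eval (z : ℝ) * (charlier t j).eval (z : ℝ) * (t ^ z / z.factorial)).det =
      (Matrix.of fun i j : Fin (K + 1) => B i (X ^ (j : ℕ))).det := by
    have h := Matrix.det_linearMap_polynomial B (fun j => charlier t j)
      (fun j => (natDegree_charlier t j).le)
    simp only [coeff_charlier, Finset.prod_const_one, mul_one] at h
    rw [← h]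
    congr 1
    ext i j
    simp only [Matrix.of_apply, hB]
    exact Finset.sum_congr rfl fun z _ => by ring
  have hL : (profileDet fun _ : Fin (K + 1) => (x : ℤ)).eval t =
      (Matrix.of fun i j : Fin (K + 1) =>
        (fwdDiff 1)^[i] (binomSum j fun z => (expMonomial z).eval t) ((x : ℤ) + (K - i))).det := by
    rw [← Matrix.det_fwdDiff_shift K (fun j => binomSum j fun z => (expMonomial z).eval t) x,
      profileDet, ← coe_evalRingHom, RingHom.map_det]
    congr 1
    ext i j
    have : ∀ (i : ℕ) (y : ℤ), (profileEntry i j y).eval t =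
        (fwdDiff 1)^[i] (binomSum j fun z => (expMonomial z).eval t) y := by
      intro i
      induction i with
      | zero => intro y; simp [profileEntry, binomSum, eval_finsetSum]
      | succ i ih => intro y; rw [profileEntry_succ, fwdDiff_iterate_succ_apply, eval_sub, ih, ih]
    simpa using this i x
  have hrow : (∏ i : Fin (K + 1), (-t) ^ (i : ℕ)) *
      (profileDet fun _ : Fin (K + 1) => (x : ℤ)).eval t =
      (Matrix.of fun i j : Fin (K + 1) => B i (q j)).det := by
    rw [hL, ← Matrix.det_mul_column]
    congr 1
    ext i j
    have h := fwdDiff_iterate_binomSum_eval ht i j (((x + K : ℕ) : ℤ))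
    rw [binomSum_natCast] at h
    rw [Matrix.of_apply, Matrix.of_apply, Matrix.of_apply, hB,
      show (x : ℤ) + (K - i) = ((x + K : ℕ) : ℤ) - i by push_cast; ring, h]
    refine Finset.sum_congr rfl fun z hz => ?_
    rw [hq3 j z (by simpa [Nat.lt_succ_iff] using hz), expMonomial_natCast, eval_monomial,
      nsmul_eq_mul]
    push_cast
    ring
  rw [hR]
  have h := Matrix.det_linearMap_polynomial B q hq1
  rw [← hrow] at h
  simp only [hq2] at h
  have hne : (∏ i : Fin (K + 1), ((-1 : ℝ) ^ (i : ℕ) / (i : ℕ).factorial)) ≠ 0 :=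
    Finset.prod_ne_zero_iff.2 fun i _ => by positivity
  apply mul_right_cancel₀ hne
  rw [← h, mul_right_comm, ← Finset.prod_mul_distrib]
  congr 1
  refine Finset.prod_congr rfl fun i _ => ?_
  have : ((i : ℕ).factorial : ℝ) ≠ 0 := by positivity
  rw [neg_pow t]
  field_simp

end RowState

end

section

/-- The Poisson weight with mean `t`. -/
noncomputable def poissonWeight (t : ℝ) (z : ℕ) : ℝ := Real.exp (-t) * (t ^ z / z.factorial)

lemma poissonWeight_nonneg {t : ℝ} (ht : 0 ≤ t) (z : ℕ) : 0 ≤ poissonWeight t z := by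
  unfold poissonWeight; positivity

lemma poissonWeight_succ (t : ℝ) (z : ℕ) :
    (z + 1 : ℝ) * poissonWeight t (z + 1) = t * poissonWeight t z := by
  have : (z : ℝ) + 1 ≠ 0 := by positivity
  have : (z.factorial : ℝ) ≠ 0 := by positivity
  rw [poissonWeight, poissonWeight, Nat.factorial_succ]
  push_cast
  field_simp
  ring

open Polynomial

lemma summable_eval_mul_poissonWeight (t : ℝ) (f : ℝ[X]) :
    Summable fun z : ℕ => f.eval (z : ℝ) * poissonWeight t z := by
  induction f using Polynomial.induction_on' with
  | add p q hp hq => simpa [add_mul] using hp.add hq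
  | monomial d a =>
    have h := (Real.summable_pow_div_factorial (Real.exp 1 * |t|)).mul_left
      (|a| * d.factorial * Real.exp (-t))
    refine Summable.of_norm_bounded h fun z => ?_
    have h1 := Real.pow_div_factorial_le_exp (z : ℝ) (Nat.cast_nonneg z) d
    rw [div_le_iff₀ (by positivity)] at h1
    have h2 : Real.exp (z : ℝ) = Real.exp 1 ^ z := by rw [← Real.exp_nat_mul, mul_one]
    rw [poissonWeight, eval_monomial, Real.norm_eq_abs, abs_mul, abs_mul, abs_mul, abs_div, abs_pow,
      abs_pow, Nat.abs_cast, Nat.abs_cast, Real.abs_exp, mul_pow, ← h2]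
    calc |a| * (z : ℝ) ^ d * (Real.exp (-t) * (|t| ^ z / z.factorial))
        ≤ |a| * (Real.exp z * d.factorial) * (Real.exp (-t) * (|t| ^ z / z.factorial)) := by gcongr
      _ = _ := by ring

/-- The mean of a polynomial under the Poisson distribution. -/
noncomputable def poissonMean (t : ℝ) : ℝ[X] →ₗ[ℝ] ℝ where
  toFun f := ∑' z : ℕ, f.eval (z : ℝ) * poissonWeight t z
  map_add' f g := by
    simp only [eval_add, add_mul]
    exact (summable_eval_mul_poissonWeight t f).tsum_add (summable_eval_mul_poissonWeight t g)
  map_smul' a f := by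
    simp only [eval_smul, smul_eq_mul, mul_assoc, RingHom.id_apply]
    exact tsum_mul_left

lemma hasSum_poissonMean (t : ℝ) (f : ℝ[X]) :
    HasSum (fun z : ℕ => f.eval (z : ℝ) * poissonWeight t z) (poissonMean t f) :=
  (summable_eval_mul_poissonWeight t f).hasSum

lemma poissonMean_one (t : ℝ) : poissonMean t 1 = 1 := by
  refine (hasSum_poissonMean t 1).unique ?_
  simp only [eval_one, one_mul, poissonWeight]
  have h := (NormedSpace.expSeries_div_hasSum_exp t).mul_left (Real.exp (-t))
  rwa [← Real.exp_eq_exp_ℝ, ← Real.exp_add, neg_add_cancel, Real.exp_zero] at h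

lemma poissonMean_X_mul_comp (t : ℝ) (f : ℝ[X]) :
    poissonMean t (X * f) = t * poissonMean t (f.comp (X + 1)) := by
  refine (hasSum_poissonMean t (X * f)).unique ?_
  rw [← hasSum_nat_add_iff' 1]
  simp only [Finset.sum_range_one, eval_mul, eval_X, Nat.cast_zero, zero_mul, sub_zero]
  refine ((hasSum_poissonMean t (f.comp (X + 1))).mul_left t).congr_fun fun z => ?_
  have := poissonWeight_succ t z
  push_cast
  simp only [eval_comp, eval_add, eval_X, eval_one]
  linear_combination f.eval ((z : ℝ) + 1) * this

/-- Adjointness of the raising operator and the forward difference. -/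
lemma poissonMean_mul_raise (t : ℝ) (f g : ℝ[X]) :
    poissonMean t (f * (X * g.comp (X - 1) - C t * g)) =
      t * poissonMean t ((f.comp (X + 1) - f) * g) := by
  have h : f * (X * g.comp (X - 1) - C t * g) = X * (f * g.comp (X - 1)) - t • (f * g) := by
    rw [smul_eq_C_mul]; ring
  rw [h, map_sub, poissonMean_X_mul_comp, map_smul, smul_eq_mul, ← mul_sub, ← map_sub]
  congr 2
  simp [mul_comp, comp_assoc, sub_mul]

lemma charlier_comp_sub (t : ℝ) (n : ℕ) :
    (charlier t (n + 1)).comp (X + 1) - charlier t (n + 1) = ((n : ℝ) + 1) • charlier t n := by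
  have key (f : ℝ[X]) : (X * f.comp (X - 1) - C t * f).comp (X + 1) -
      (X * f.comp (X - 1) - C t * f) =
      X * (f.comp (X + 1) - f).comp (X - 1) - C t * (f.comp (X + 1) - f) + f := by
    simp [comp_assoc]
    ring
  induction n with
  | zero => simp [charlier]
  | succ n ih =>
    rw [charlier, key, ih, smul_comp, charlier]
    simp only [smul_eq_C_mul]
    push_cast
    simp only [C_add, C_1]
    ring

lemma poissonMean_charlier_mul (t : ℝ) (m n : ℕ) :
    poissonMean t (charlier t m * charlier t n) = if m = n then n.factorial * t ^ n else 0 := by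
  induction n generalizing m with
  | zero =>
    cases m with
    | zero => simp [charlier, poissonMean_one]
    | succ m =>
      rw [mul_comm, charlier.eq_2, poissonMean_mul_raise]
      simp [charlier]
  | succ n ih =>
    conv_lhs => rw [charlier.eq_2]
    rw [poissonMean_mul_raise]
    cases m with
    | zero => simp [charlier]
    | succ m =>
      rw [charlier_comp_sub, smul_mul_assoc, map_smul, ih]
      simp only [Nat.add_right_cancel_iff, smul_eq_mul]
      split_ifs with h
      · rw [h, Nat.factorial_succ]; push_cast; ring
      · simp

lemma X_mul_charlier_succ (t : ℝ) (n : ℕ) :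
    X * charlier t (n + 1) = charlier t (n + 2) + C ((n : ℝ) + 1 + t) * charlier t (n + 1) +
      C (t * ((n : ℝ) + 1)) * charlier t n := by
  have h := charlier_comp_sub t n
  have h2 : charlier t (n + 2) = X * (charlier t (n + 1)).comp (X - 1) - C t * charlier t (n + 1) :=
    rfl
  have h1 : charlier t (n + 1) = X * (charlier t n).comp (X - 1) - C t * charlier t n := rfl
  have h3 := congrArg (fun f : ℝ[X] => f.comp (X - 1)) h
  simp only [sub_comp, comp_assoc, add_comp, X_comp, one_comp, sub_add_cancel,
    comp_X, smul_eq_C_mul] at h3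
  rw [h2]
  simp only [C_add, C_1, C_mul, mul_comp, add_comp, C_comp, one_comp] at h3 ⊢
  linear_combination X * h3 - (C (n : ℝ) + 1) * h1

lemma X_mul_charlier_zero (t : ℝ) : X * charlier t 0 = charlier t 1 + C t * charlier t 0 := by
  simp [charlier]

/-- The orthonormal Charlier polynomials. -/
noncomputable def charlierNormalized (t : ℝ) (n : ℕ) : ℝ[X] :=
  (√(t ^ n * n.factorial))⁻¹ • charlier t n

lemma poissonMean_charlierNormalized_mul {t : ℝ} (ht : 0 < t) (m n : ℕ) :
    poissonMean t (charlierNormalized t m * charlierNormalized t n) = if m = n then 1 else 0 := by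
  rw [charlierNormalized, charlierNormalized, smul_mul_smul_comm, map_smul,
    poissonMean_charlier_mul]
  split_ifs with h
  · subst h
    have h0 : 0 < t ^ m * m.factorial := by positivity
    rw [← mul_inv, Real.mul_self_sqrt h0.le, smul_eq_mul]
    field_simp
  · simp

lemma X_mul_charlierNormalized_succ {t : ℝ} (ht : 0 < t) (n : ℕ) :
    X * charlierNormalized t (n + 1) = √(t * (n + 2)) • charlierNormalized t (n + 2) +
      ((n : ℝ) + 1 + t) • charlierNormalized t (n + 1) +
      √(t * (n + 1)) • charlierNormalized t n := by
  have e (n : ℕ) : √(t ^ (n + 1) * (n + 1).factorial) = √(t * (n + 1)) * √(t ^ n * n.factorial) := by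
    rw [← Real.sqrt_mul (by positivity), Nat.factorial_succ]
    congr 1
    push_cast
    ring
  have e1 := e n
  have e2 := e (n + 1)
  push_cast at e2
  rw [show (n : ℝ) + 1 + 1 = n + 2 by ring] at e2
  have p0 : √(t ^ n * n.factorial) ≠ 0 := (Real.sqrt_pos.2 (by positivity)).ne'
  have p1 : √(t * (n + 1)) ≠ 0 := (Real.sqrt_pos.2 (by positivity)).ne'
  have p2 : √(t * (n + 2)) ≠ 0 := (Real.sqrt_pos.2 (by positivity)).ne'
  have s1 : √(t * (n + 1)) * √(t * (n + 1)) = t * (n + 1) := Real.mul_self_sqrt (by positivity)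
  unfold charlierNormalized
  rw [mul_smul_comm, X_mul_charlier_succ, e2, e1]
  simp only [smul_add, smul_eq_C_mul, ← mul_assoc, ← C_mul]
  congr 1
  · congr 1
    · congr 2
      field_simp
    · congr 2
      ring
  · congr 2
    field_simp
    linarith

lemma X_mul_charlierNormalized_zero {t : ℝ} (ht : 0 < t) :
    X * charlierNormalized t 0 = √t • charlierNormalized t 1 + t • charlierNormalized t 0 := by
  have : √t ≠ 0 := (Real.sqrt_pos.2 ht).ne'
  have h : charlierNormalized t 1 = (√t)⁻¹ • charlier t 1 := by simp [charlierNormalized]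
  rw [h, smul_smul, mul_inv_cancel₀ this]
  simp [charlierNormalized, X_mul_charlier_zero, smul_eq_C_mul]

lemma poissonMean_X_mul_charlierNormalized_sq {t : ℝ} (ht : 0 < t) (n : ℕ) :
    poissonMean t (X * charlierNormalized t n * charlierNormalized t n) = n + t := by
  cases n with
  | zero =>
    rw [X_mul_charlierNormalized_zero ht]
    simp [add_mul, poissonMean_charlierNormalized_mul ht]
  | succ n =>
    rw [X_mul_charlierNormalized_succ ht]
    simp [add_mul, poissonMean_charlierNormalized_mul ht]

lemma poissonMean_X_mul_charlierNormalized_succ {t : ℝ} (ht : 0 < t) (n : ℕ) :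
    poissonMean t (X * charlierNormalized t n * charlierNormalized t (n + 1)) =
      √(t * (n + 1)) := by
  cases n with
  | zero =>
    rw [X_mul_charlierNormalized_zero ht]
    simp [add_mul, poissonMean_charlierNormalized_mul ht]
  | succ n =>
    rw [X_mul_charlierNormalized_succ ht]
    simp [add_mul, poissonMean_charlierNormalized_mul ht]
    ring_nf
    rw [if_neg (by omega), add_zero]

lemma poissonMean_X_mul_charlierNormalized_of_lt {t : ℝ} (ht : 0 < t) {m n : ℕ} (h : m + 1 < n) :
    poissonMean t (X * charlierNormalized t m * charlierNormalized t n) = 0 := by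
  cases m with
  | zero =>
    rw [X_mul_charlierNormalized_zero ht]
    simp only [add_mul, map_add, smul_mul_assoc, map_smul, poissonMean_charlierNormalized_mul ht]
    rw [if_neg (by omega), if_neg (by omega)]
    simp
  | succ m =>
    rw [X_mul_charlierNormalized_succ ht]
    simp only [add_mul, map_add, smul_mul_assoc, map_smul, poissonMean_charlierNormalized_mul ht]
    rw [if_neg (by omega), if_neg (by omega), if_neg (by omega)]
    simp

lemma poissonMean_sum_charlierNormalized_sq {t : ℝ} (ht : 0 < t) (c : ℕ → ℝ) (k : ℕ) :
    poissonMean t ((∑ i ∈ Finset.range k, c i • charlierNormalized t i) ^ 2) =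
      ∑ i ∈ Finset.range k, c i ^ 2 := by
  rw [sq, Finset.sum_mul_sum, map_sum]
  refine Finset.sum_congr rfl fun i hi => ?_
  simp only [map_sum, smul_mul_smul_comm, map_smul, poissonMean_charlierNormalized_mul ht]
  simp [Finset.mem_range.1 hi, sq]

lemma poissonMean_X_mul_sum_charlierNormalized_sq {t : ℝ} (ht : 0 < t) (c : ℕ → ℝ) (k : ℕ) :
    poissonMean t (X * (∑ i ∈ Finset.range (k + 1), c i • charlierNormalized t i) ^ 2) =
      ∑ i ∈ Finset.range (k + 1), c i ^ 2 * (i + t) +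
        2 * ∑ i ∈ Finset.range k, c i * c (i + 1) * √(t * (i + 1)) := by
  have step (V : ℝ[X]) (n : ℕ) : X * (V + c n • charlierNormalized t n) ^ 2 =
      X * V ^ 2 + (2 * c n) • (X * V * charlierNormalized t n) +
        c n ^ 2 • (X * charlierNormalized t n * charlierNormalized t n) := by
    simp only [smul_eq_C_mul, C_mul, C_pow, C_ofNat]
    ring
  induction k with
  | zero =>
    have := step 0 0
    rw [zero_add] at this
    rw [zero_add, Finset.sum_range_one, this]
    simp [poissonMean_X_mul_charlierNormalized_sq ht]
  | succ k ih =>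
    have cross : poissonMean t (X * (∑ i ∈ Finset.range (k + 1), c i • charlierNormalized t i) *
        charlierNormalized t (k + 1)) = c k * √(t * (k + 1)) := by
      rw [Finset.mul_sum, Finset.sum_mul, map_sum, Finset.sum_range_succ, Finset.sum_eq_zero,
        zero_add, mul_smul_comm, smul_mul_assoc, map_smul,
        poissonMean_X_mul_charlierNormalized_succ ht, smul_eq_mul]
      intro i hi
      rw [mul_smul_comm, smul_mul_assoc, map_smul, poissonMean_X_mul_charlierNormalized_of_lt ht
        (by have := Finset.mem_range.1 hi; omega), smul_zero]
    rw [Finset.sum_range_succ _ (k + 1), step, map_add, map_add, ih, map_smul, map_smul, cross,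
      poissonMean_X_mul_charlierNormalized_sq ht, Finset.sum_range_succ _ (k + 1),
      Finset.sum_range_succ (fun i => c i * c (i + 1) * √(t * (i + 1))) k]
    simp only [smul_eq_mul]
    ring

end

section

namespace Matrix

/-- A contractive positive semidefinite form is bounded below by its determinant. -/
lemma det_mul_dotProduct_le {n : Type*} [Fintype n] [DecidableEq n] {G : Matrix n n ℝ}
    (hG : G.IsHermitian) (h0 : ∀ x, 0 ≤ x ⬝ᵥ G *ᵥ x) (h1 : ∀ x, x ⬝ᵥ G *ᵥ x ≤ x ⬝ᵥ x) (x : n → ℝ) :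
    G.det * (x ⬝ᵥ x) ≤ x ⬝ᵥ G *ᵥ x := by
  have hle (i : n) : hG.eigenvalues i ≤ 1 := by
    have h := hG.eigenvalues_eq i
    have h2 := h1 (hG.eigenvectorBasis i)
    have h3 : (hG.eigenvectorBasis i : n → ℝ) ⬝ᵥ (hG.eigenvectorBasis i : n → ℝ) = 1 := by
      have := hG.eigenvectorBasis.orthonormal.1 i
      rw [EuclideanSpace.norm_eq, Real.sqrt_eq_one] at this
      rw [← this, dotProduct]
      exact Finset.sum_congr rfl fun j _ => by rw [Real.norm_eq_abs, sq_abs, sq]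
    rw [h3] at h2
    rw [h]
    simpa using h2
  have hpos : G.PosSemidef := .of_dotProduct_mulVec_nonneg hG fun x => by simpa using h0 x
  have hdet (i : n) : G.det ≤ hG.eigenvalues i := by
    rw [hG.det_eq_prod_eigenvalues, ← Finset.mul_prod_erase _ _ (Finset.mem_univ i)]
    simp only [RCLike.ofReal_real_eq_id, id]
    exact mul_le_of_le_one_right (hpos.eigenvalues_nonneg i)
      (Finset.prod_le_one (fun j _ => hpos.eigenvalues_nonneg j) fun j _ => hle j)
  have hsub : (G - algebraMap ℝ (Matrix n n ℝ) G.det).PosSemidef := by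
    rw [posSemidef_iff_isHermitian_and_spectrum_nonneg]
    refine ⟨hG.sub ?_, ?_⟩
    · rw [algebraMap_eq_diagonal]
      exact isHermitian_diagonal _
    · rw [← spectrum.sub_singleton_eq, hG.spectrum_real_eq_range_eigenvalues]
      rintro _ ⟨_, ⟨i, rfl⟩, _, rfl, rfl⟩
      exact sub_nonneg.2 (hdet i)
  have h := hsub.dotProduct_mulVec_nonneg x
  rw [Algebra.algebraMap_eq_smul_one, sub_mulVec, smul_mulVec, one_mulVec, dotProduct_sub,
    dotProduct_smul] at h
  simpa using h

end Matrix

open Polynomial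

namespace RowState

lemma exp_mul_eval_profileDet_le {t : ℝ} (ht : 0 < t) (K x : ℕ) (c : ℕ → ℝ) :
    Real.exp (-((K + 1 : ℕ) * t)) * (profileDet fun _ : Fin (K + 1) => (x : ℤ)).eval t *
        ∑ i ∈ Finset.range (K + 1), c i ^ 2 ≤
      ∑ z ∈ Finset.range (x + K + 1),
        ((∑ i ∈ Finset.range (K + 1), c i • charlierNormalized t i) ^ 2).eval (z : ℝ) *
          poissonWeight t z := by
  set G : Matrix (Fin (K + 1)) (Fin (K + 1)) ℝ := Matrix.of fun i j =>
    ∑ z ∈ Finset.range (x + K + 1), (charlierNormalized t i).eval (z : ℝ) *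
      (charlierNormalized t j).eval (z : ℝ) * poissonWeight t z with hGdef
  have hdet : G.det = Real.exp (-((K + 1 : ℕ) * t)) *
      (profileDet fun _ : Fin (K + 1) => (x : ℤ)).eval t := by
    have h := eval_profileDet_const ht.ne' K x
    have hG : G = Matrix.of fun i j : Fin (K + 1) => (Real.exp (-t) * (√(t ^ (i : ℕ) * (i : ℕ).factorial))⁻¹) *
        (Matrix.of fun i j : Fin (K + 1) => (√(t ^ (j : ℕ) * (j : ℕ).factorial))⁻¹ *
        (Matrix.of fun i j : Fin (K + 1) => ∑ z ∈ Finset.range (x + K + 1),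
          (charlier t i).eval (z : ℝ) * (charlier t j).eval (z : ℝ) *
            (t ^ z / z.factorial)) i j) i j := by
      ext i j
      simp only [hGdef, Matrix.of_apply, Finset.mul_sum, charlierNormalized, eval_smul, smul_eq_mul,
        poissonWeight]
      exact Finset.sum_congr rfl fun z _ => by ring
    rw [hG, Matrix.det_mul_column, Matrix.det_mul_row, ← h, ← mul_assoc, ← mul_assoc,
      ← Finset.prod_mul_distrib, ← Finset.prod_mul_distrib]
    congr 1
    have (i : Fin (K + 1)) : Real.exp (-t) * (√(t ^ (i : ℕ) * (i : ℕ).factorial))⁻¹ *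
        (√(t ^ (i : ℕ) * (i : ℕ).factorial))⁻¹ * (t ^ (i : ℕ) * (i : ℕ).factorial) =
        Real.exp (-t) := by
      have h0 : 0 < t ^ (i : ℕ) * ((i : ℕ).factorial : ℝ) := by positivity
      rw [mul_assoc (Real.exp _), ← mul_inv, Real.mul_self_sqrt h0.le, mul_assoc,
        inv_mul_cancel₀ h0.ne', mul_one]
    simp only [this, Finset.prod_const, Finset.card_univ, Fintype.card_fin]
    rw [← Real.exp_nat_mul]
    congr 1
    ring
  have hquad (c : ℕ → ℝ) : (fun i : Fin (K + 1) => c i) ⬝ᵥ G.mulVec (fun i : Fin (K + 1) => c i) =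
      ∑ z ∈ Finset.range (x + K + 1),
        ((∑ i ∈ Finset.range (K + 1), c i • charlierNormalized t i) ^ 2).eval (z : ℝ) *
          poissonWeight t z := by
    simp only [dotProduct, Matrix.mulVec, hGdef, Matrix.of_apply, Finset.sum_mul, Finset.mul_sum,
      eval_finsetSum, sq, Finset.sum_range (n := K + 1)]
    rw [Finset.sum_congr rfl fun i _ => Finset.sum_comm, Finset.sum_comm]
    refine Finset.sum_congr rfl fun z _ => Finset.sum_congr rfl fun i _ =>
      Finset.sum_congr rfl fun j _ => by
        simp only [eval_mul, eval_smul, smul_eq_mul]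
        ring
  have hself (c : ℕ → ℝ) : (fun i : Fin (K + 1) => c i) ⬝ᵥ (fun i : Fin (K + 1) => c i) =
      ∑ i ∈ Finset.range (K + 1), c i ^ 2 := by
    simp [dotProduct, sq, Finset.sum_range]
  have hnonneg (c : ℕ → ℝ) (z : ℕ) :
      0 ≤ ((∑ i ∈ Finset.range (K + 1), c i • charlierNormalized t i) ^ 2).eval (z : ℝ) *
          poissonWeight t z := by
    rw [eval_pow]
    exact mul_nonneg (sq_nonneg _) (poissonWeight_nonneg ht.le z)
  have hext (c : Fin (K + 1) → ℝ) : ∃ c' : ℕ → ℝ, c = fun i : Fin (K + 1) => c' i :=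
    ⟨fun i => if h : i < K + 1 then c ⟨i, h⟩ else 0, funext fun i => by simp only [i.2, dif_pos]⟩
  rw [← hdet, ← hquad, ← hself]
  refine Matrix.det_mul_dotProduct_le ?_ (fun c => ?_) (fun c => ?_) _
  · ext i j
    simp only [hGdef, Matrix.conjTranspose_apply, Matrix.of_apply, star_trivial]
    exact Finset.sum_congr rfl fun z _ => by ring
  · obtain ⟨c, rfl⟩ := hext c
    rw [hquad]
    exact Finset.sum_nonneg fun z _ => hnonneg c z
  · obtain ⟨c, rfl⟩ := hext c
    rw [hquad, hself, ← poissonMean_sum_charlierNormalized_sq ht]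
    exact sum_le_hasSum _ (fun z _ => hnonneg c z) (hasSum_poissonMean t _)

end RowState

end

section

open Polynomial

namespace RowState

lemma mul_pow_le_sum_add_totalLNDS (k m T : ℕ) :
    T * k ^ m ≤ ∑ x ∈ Finset.range T,
      insSum^[m] (fun s : RowState k => if size k s ≤ x then 1 else 0) (empty k) +
        totalLNDS k m := by
  have hpt (s : RowState k) : T ≤ ∑ x ∈ Finset.range T, (if size k s ≤ x then 1 else 0) +
      size k s := by
    induction T with
    | zero => simp
    | succ T ih => rw [Finset.sum_range_succ]; split_ifs <;> omega
  unfold totalLNDS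
  simp_rw [← sum_insWord]
  rw [Finset.sum_comm, ← Finset.sum_add_distrib]
  calc T * k ^ m = ∑ _u : Fin m → Fin k, T := by simp [mul_comm]
    _ ≤ _ := Finset.sum_le_sum fun u _ => hpt _

lemma expLNDS_nonneg (k m : ℕ) : 0 ≤ expLNDS k m := by
  rw [expLNDS_eq]; positivity

lemma expLNDS_le_three_mul {k : ℕ} (hk : 1 ≤ k) (m : ℕ) : expLNDS k m ≤ 3 * m := by
  refine (expLNDS_le hk m).trans ?_
  have h1 : (m : ℝ) / k ≤ m := div_le_self (Nat.cast_nonneg m) (by exact_mod_cast hk)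
  have h2 : √(m : ℝ) ≤ m := by
    rw [Real.sqrt_le_left (Nat.cast_nonneg m)]
    exact_mod_cast Nat.le_self_pow two_ne_zero m
  linarith

lemma summable_poissonWeight_mul_expLNDS {k : ℕ} (hk : 1 ≤ k) {N : ℝ} (hN : 0 ≤ N) :
    Summable fun m => poissonWeight N m * expLNDS k m := by
  refine Summable.of_nonneg_of_le
    (fun m => mul_nonneg (poissonWeight_nonneg hN m) (expLNDS_nonneg k m)) (fun m => ?_)
    (summable_eval_mul_poissonWeight N (C 3 * X))
  rw [mul_comm, eval_mul, eval_C, eval_X]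
  exact mul_le_mul_of_nonneg_right (expLNDS_le_three_mul hk m) (poissonWeight_nonneg hN m)

lemma sum_one_sub_le_tsum_expLNDS {k : ℕ} (hk : 1 ≤ k) {t : ℝ} (ht : 0 < t) (T : ℕ) :
    ∑ x ∈ Finset.range T,
        (1 - Real.exp (-(k * t)) * (profileDet fun _ : Fin k => (x : ℤ)).eval t) ≤
      ∑' m, poissonWeight (k * t) m * expLNDS k m := by
  have hkt : 0 ≤ k * t := by positivity
  have hone : HasSum (poissonWeight (k * t)) 1 := by
    simpa [poissonMean_one] using hasSum_poissonMean (k * t) 1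
  have hsum := hasSum_sum (s := Finset.range T) fun x _ =>
    hone.sub ((hasSum_iterate_insSum_le (k := k) x t).mul_left (Real.exp (-(k * t))))
  refine hasSum_le (fun m => ?_) hsum (summable_poissonWeight_mul_expLNDS hk hkt).hasSum
  have hk0 : (0 : ℝ) < (k : ℝ) ^ m := by
    have : 0 < k := hk
    positivity
  have h : (T : ℝ) * k ^ m ≤ ∑ x ∈ Finset.range T, ((insSum^[m]
      (fun s : RowState k => if size k s ≤ x then 1 else 0) (empty k) : ℕ) : ℝ) +
        totalLNDS k m := by
    exact_mod_cast mul_pow_le_sum_add_totalLNDS k m T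
  rw [Finset.sum_sub_distrib, ← Finset.mul_sum, ← Finset.mul_sum, expLNDS_eq, Finset.sum_const,
    Finset.card_range, nsmul_eq_mul, poissonWeight, mul_pow]
  have h2 : 0 ≤ Real.exp (-(k * t)) * (t ^ m / m.factorial) := by positivity
  have h3 := mul_le_mul_of_nonneg_left h h2
  have h4 : Real.exp (-(k * t)) * ((k : ℝ) ^ m * t ^ m / m.factorial) * (totalLNDS k m / (k : ℝ) ^ m) =
      Real.exp (-(k * t)) * (t ^ m / m.factorial) * totalLNDS k m := by
    field_simp
  rw [h4]
  linear_combination h3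

lemma sum_sub_mul_le (K T : ℕ) {U : ℕ → ℝ} (hU : ∀ z, 0 ≤ U z) (hU1 : HasSum U 1) :
    ∑ z ∈ Finset.range (T + K + 1), ((z : ℝ) - K) * U z ≤
      ∑ x ∈ Finset.range T, (1 - ∑ z ∈ Finset.range (x + K + 1), U z) := by
  have hpt (z : ℕ) (hz : z < T + K + 1) :
      (z : ℝ) - K ≤ ∑ x ∈ Finset.range T, (if x + K + 1 ≤ z then 1 else 0 : ℝ) := by
    rw [Finset.sum_boole]
    have : z - K ≤ (Finset.filter (fun x => x + K + 1 ≤ z) (Finset.range T)).card := by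
      calc z - K = (Finset.range (z - K)).card := (Finset.card_range _).symm
        _ ≤ _ := Finset.card_le_card fun x hx => by
          simp only [Finset.mem_range, Finset.mem_filter] at hx ⊢
          omega
    have h' : (z : ℝ) ≤ ((z - K : ℕ) : ℝ) + K := by
      exact_mod_cast (by omega : z ≤ z - K + K)
    have : ((z - K : ℕ) : ℝ) ≤ ((Finset.filter (fun x => x + K + 1 ≤ z) (Finset.range T)).card : ℝ) :=
      by exact_mod_cast this
    linarith
  calc ∑ z ∈ Finset.range (T + K + 1), ((z : ℝ) - K) * U z
      ≤ ∑ z ∈ Finset.range (T + K + 1),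
        (∑ x ∈ Finset.range T, (if x + K + 1 ≤ z then 1 else 0 : ℝ)) * U z :=
        Finset.sum_le_sum fun z hz =>
          mul_le_mul_of_nonneg_right (hpt z (Finset.mem_range.1 hz)) (hU z)
    _ = ∑ x ∈ Finset.range T, ∑ z ∈ Finset.range (T + K + 1), (if x + K + 1 ≤ z then U z else 0) := by
        simp only [Finset.sum_mul, ite_mul, one_mul, zero_mul]
        exact Finset.sum_comm
    _ ≤ _ := by
        refine Finset.sum_le_sum fun x hx => ?_
        have hx' := Finset.mem_range.1 hx
        have h1 := sum_le_hasSum (Finset.range (T + K + 1)) (fun z _ => hU z) hU1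
        have h2 : ∑ z ∈ Finset.range (T + K + 1), U z = ∑ z ∈ Finset.range (x + K + 1), U z +
            ∑ z ∈ Finset.range (T + K + 1), (if x + K + 1 ≤ z then U z else 0) := by
          have h3 : ∑ z ∈ Finset.range (x + K + 1), U z =
              ∑ z ∈ Finset.range (T + K + 1), (if x + K + 1 ≤ z then 0 else U z) := by
            rw [← Finset.sum_subset (Finset.range_mono (show x + K + 1 ≤ T + K + 1 by omega))]
            · exact Finset.sum_congr rfl fun z hz => by
                rw [if_neg (by simpa using hz)]
            · intro z _ hz
              rw [if_pos (by simpa using hz)]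
          rw [h3, ← Finset.sum_add_distrib]
          exact Finset.sum_congr rfl fun z _ => by split_ifs <;> simp
        linarith

/-- Variational lower bound for the Poissonized expectation. -/
lemma poissonMean_le_tsum_expLNDS {t : ℝ} (ht : 0 < t) (K : ℕ) (c : ℕ → ℝ)
    (hc : ∑ i ∈ Finset.range (K + 1), c i ^ 2 = 1) :
    poissonMean t (X * (∑ i ∈ Finset.range (K + 1), c i • charlierNormalized t i) ^ 2) - K ≤
      ∑' m, poissonWeight ((K + 1 : ℕ) * t) m * expLNDS (K + 1) m := by
  set V := ∑ i ∈ Finset.range (K + 1), c i • charlierNormalized t i with hV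
  set U : ℕ → ℝ := fun z => (V ^ 2).eval (z : ℝ) * poissonWeight t z with hUdef
  have hmean : poissonMean t (V ^ 2) = 1 := by
    rw [poissonMean_sum_charlierNormalized_sq ht, hc]
  have hU1 : HasSum U 1 := hmean ▸ hasSum_poissonMean t (V ^ 2)
  have hU (z : ℕ) : 0 ≤ U z := by
    simp only [hUdef, eval_pow]
    exact mul_nonneg (sq_nonneg _) (poissonWeight_nonneg ht.le z)
  have hlim : HasSum (fun z : ℕ => ((z : ℝ) - K) * U z) (poissonMean t (X * V ^ 2) - K) := by
    have h := (hasSum_poissonMean t (X * V ^ 2)).sub (hU1.mul_left (K : ℝ))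
    rw [mul_one] at h
    refine h.congr_fun fun z => ?_
    simp only [hUdef, eval_mul, eval_X]
    ring
  have htend := hlim.tendsto_sum_nat.comp (Filter.tendsto_add_atTop_nat (K + 1))
  refine le_of_tendsto htend (Filter.Eventually.of_forall fun T => ?_)
  refine (sum_sub_mul_le K T hU hU1).trans (le_trans ?_
    (sum_one_sub_le_tsum_expLNDS (Nat.succ_pos K) ht T))
  refine Finset.sum_le_sum fun x _ => ?_
  have := exp_mul_eval_profileDet_le ht K x c
  rw [hc, mul_one] at this
  exact sub_le_sub_left this 1

end RowState

end

lemma two_mul_sum_sin_mul_sin (q : ℕ) :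
    ∑ j ∈ Finset.range q,
        Real.sin (Real.pi / (q + 2) * (j + 1 : ℕ)) * Real.sin (Real.pi / (q + 2) * (j + 2 : ℕ)) =
      Real.cos (Real.pi / (q + 2)) *
        ∑ j ∈ Finset.range (q + 1), Real.sin (Real.pi / (q + 2) * (j + 1 : ℕ)) ^ 2 := by
  set θ := Real.pi / (q + 2) with hθ
  have hrec (j : ℕ) : 2 * (Real.cos θ * Real.sin (θ * (j + 1 : ℕ)) ^ 2) =
      Real.sin (θ * (j : ℕ)) * Real.sin (θ * (j + 1 : ℕ)) +
        Real.sin (θ * (j + 1 : ℕ)) * Real.sin (θ * (j + 2 : ℕ)) := by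
    have h1 : θ * (j : ℕ) = θ * (j + 1 : ℕ) - θ := by push_cast; ring
    have h2 : θ * (j + 2 : ℕ) = θ * (j + 1 : ℕ) + θ := by push_cast; ring
    rw [h1, h2, Real.sin_sub, Real.sin_add]
    ring
  have hend : Real.sin (θ * (q + 2 : ℕ)) = 0 := by
    have : θ * (q + 2 : ℕ) = Real.pi := by
      rw [hθ]; push_cast; field_simp
    rw [this, Real.sin_pi]
  have h := Finset.sum_congr rfl fun j (_ : j ∈ Finset.range (q + 1)) => hrec j
  have h1 := Finset.sum_range_succ'
    (fun j : ℕ => Real.sin (θ * (j : ℕ)) * Real.sin (θ * (j + 1 : ℕ))) q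
  have h2 := Finset.sum_range_succ
    (fun j : ℕ => Real.sin (θ * (j + 1 : ℕ)) * Real.sin (θ * (j + 2 : ℕ))) q
  rw [hend, mul_zero, add_zero] at h2
  simp only [Nat.cast_zero, mul_zero, Real.sin_zero, zero_mul, add_zero, add_assoc,
    one_add_one_eq_two] at h1
  rw [Finset.sum_add_distrib, h1, h2, ← Finset.mul_sum, ← Finset.mul_sum] at h
  linarith

namespace RowState

lemma add_sqrt_mul_cos_le_tsum_expLNDS {t : ℝ} (ht : 0 < t) (a q : ℕ) :
    t + 2 * √(t * a) * Real.cos (Real.pi / (q + 2)) - (a + q : ℕ) ≤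
      ∑' m, poissonWeight ((a + q + 1 : ℕ) * t) m * expLNDS (a + q + 1) m := by
  set s : ℕ → ℝ := fun j => Real.sin (Real.pi / (q + 2) * (j : ℕ)) with hs
  set S := ∑ j ∈ Finset.range (q + 1), s (j + 1) ^ 2 with hS
  have hspos (j : ℕ) (hj : j < q + 1) : 0 < s (j + 1) := by
    have hq : (0 : ℝ) < q + 2 := by positivity
    refine Real.sin_pos_of_pos_of_lt_pi (by have := Real.pi_pos; positivity) ?_
    rw [div_mul_eq_mul_div, div_lt_iff₀ hq]
    refine mul_lt_mul_of_pos_left ?_ Real.pi_pos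
    exact_mod_cast (by omega : j + 1 < q + 2)
  have hSpos : 0 < S := Finset.sum_pos (fun j hj => by
    have := hspos j (Finset.mem_range.1 hj)
    positivity) ⟨0, by simp⟩
  have hsq : √S ^ 2 = S := Real.sq_sqrt hSpos.le
  set c : ℕ → ℝ := fun i => if i < a then 0 else s (i - a + 1) / √S with hc
  have hclt (i : ℕ) (hi : i < a) : c i = 0 := if_pos hi
  have hcge (j : ℕ) : c (a + j) = s (j + 1) / √S := by
    simp [hc]
  have hnorm : ∑ i ∈ Finset.range (a + q + 1), c i ^ 2 = 1 := by
    rw [add_assoc, Finset.sum_range_add, Finset.sum_eq_zero fun i hi => by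
      rw [hclt i (Finset.mem_range.1 hi)]; simp, zero_add]
    simp_rw [hcge, div_pow, hsq]
    rw [← Finset.sum_div, div_self hSpos.ne']
  have hdiag : t ≤ ∑ i ∈ Finset.range (a + q + 1), c i ^ 2 * (i + t) := by
    calc t = ∑ i ∈ Finset.range (a + q + 1), c i ^ 2 * t := by rw [← Finset.sum_mul, hnorm, one_mul]
      _ ≤ _ := Finset.sum_le_sum fun i _ => by gcongr; simp
  have hoff : √(t * a) * Real.cos (Real.pi / (q + 2)) ≤
      ∑ i ∈ Finset.range (a + q), c i * c (i + 1) * √(t * (i + 1)) := by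
    rw [Finset.sum_range_add, Finset.sum_eq_zero fun i hi => by
      rw [hclt i (Finset.mem_range.1 hi)]; simp, zero_add]
    have hcos : Real.cos (Real.pi / (q + 2)) =
        ∑ j ∈ Finset.range q, s (j + 1) * s (j + 2) / S := by
      rw [← Finset.sum_div, eq_div_iff hSpos.ne']
      exact (two_mul_sum_sin_mul_sin q).symm
    rw [hcos, Finset.mul_sum]
    refine Finset.sum_le_sum fun j hj => ?_
    have hj := Finset.mem_range.1 hj
    rw [hcge, add_assoc, hcge, div_mul_div_comm, Real.mul_self_sqrt hSpos.le, mul_comm]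
    have h1 := hspos j (by omega)
    have h2 := hspos (j + 1) (by omega)
    refine mul_le_mul_of_nonneg_left (Real.sqrt_le_sqrt ?_)
      (div_nonneg (mul_nonneg h1.le h2.le) hSpos.le)
    refine mul_le_mul_of_nonneg_left ?_ ht.le
    push_cast
    have : (0 : ℝ) ≤ j := Nat.cast_nonneg j
    linarith
  have h := poissonMean_le_tsum_expLNDS ht (a + q) c hnorm
  rw [poissonMean_X_mul_sum_charlierNormalized_sq ht] at h
  linarith

/-- Lower bound for the expectation of the longest non-decreasing subsequence of a uniformly random
word of Poisson length. -/
lemma le_tsum_poissonWeight_mul_expLNDS {k : ℕ} (hk : 1 ≤ k) {N : ℝ} (hN : 0 < N) :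
    N / k + 2 * √N * (1 - 7 * (k : ℝ) ^ (-(2 : ℝ) / 3)) - k ≤
      ∑' m, poissonWeight N m * expLNDS k m := by
  have hk1 : (1 : ℝ) ≤ k := by exact_mod_cast hk
  have hk0 : (0 : ℝ) < k := by linarith
  set x := (k : ℝ) ^ ((1 : ℝ) / 3) with hx
  have hx1 : 1 ≤ x := Real.one_le_rpow hk1 (by norm_num)
  have hx0 : 0 < x := by linarith
  have hx3 : x ^ 3 = k := by
    rw [hx, ← Real.rpow_natCast, ← Real.rpow_mul hk0.le]; norm_num
  have hy : (k : ℝ) ^ (-(2 : ℝ) / 3) = 1 / x ^ 2 := by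
    rw [hx, ← Real.rpow_natCast, ← Real.rpow_mul hk0.le, one_div, ← Real.rpow_neg hk0.le]; norm_num
  obtain ⟨q, hq⟩ : ∃ q, ⌈x⌉₊ = q + 1 :=
    ⟨⌈x⌉₊ - 1, by have : 0 < ⌈x⌉₊ := Nat.ceil_pos.2 hx0; omega⟩
  have hxk : x ≤ k := by
    rw [← hx3]; exact le_self_pow₀ hx1 (by norm_num)
  have hqk : q + 1 ≤ k := by rw [← hq]; exact Nat.ceil_le.2 hxk
  have hxq : x ≤ q + 1 := by
    have := Nat.le_ceil x
    rw [hq] at this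
    exact_mod_cast this
  have hqx : (q : ℝ) + 1 ≤ 2 * x := by
    have := Nat.ceil_lt_add_one hx0.le
    rw [hq] at this
    push_cast at this
    linarith
  obtain ⟨a, ha⟩ : ∃ a, k = a + q + 1 := ⟨k - (q + 1), by omega⟩
  have haR : (k : ℝ) = a + q + 1 := by exact_mod_cast ha
  have h := add_sqrt_mul_cos_le_tsum_expLNDS (div_pos hN hk0) a q
  rw [← ha, mul_div_cancel₀ _ hk0.ne'] at h
  refine le_trans ?_ h
  have hθ : Real.pi / (q + 2) ≤ Real.pi / x :=
    div_le_div_of_nonneg_left Real.pi_pos.le hx0 (by linarith)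
  have hcos : 1 - 5 / x ^ 2 ≤ Real.cos (Real.pi / (q + 2)) := by
    refine le_trans ?_ (Real.one_sub_sq_div_two_le_cos)
    have h1 : (Real.pi / (q + 2)) ^ 2 ≤ (Real.pi / x) ^ 2 := by
      have := Real.pi_pos
      gcongr
    have h2 : (Real.pi / x) ^ 2 ≤ 10 / x ^ 2 := by
      rw [div_pow]
      have := Real.pi_lt_d2
      have := Real.pi_pos
      gcongr
      nlinarith
    have : (10 : ℝ) / x ^ 2 = 2 * (5 / x ^ 2) := by ring
    linarith
  have hcos0 : 0 ≤ Real.cos (Real.pi / (q + 2)) := by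
    refine Real.cos_nonneg_of_neg_pi_div_two_le_of_le ?_ ?_
    · have := Real.pi_pos
      have : 0 ≤ Real.pi / ((q : ℝ) + 2) := by positivity
      linarith
    · exact div_le_div_of_nonneg_left Real.pi_pos.le two_pos (by simp)
  have hak : 1 - 2 / x ^ 2 ≤ a / (k : ℝ) := by
    have h1 : (a : ℝ) = k - (q + 1) := by linarith
    rw [h1, sub_div, div_self hk0.ne']
    have h2 : ((q : ℝ) + 1) / k ≤ 2 * x / x ^ 3 := by
      rw [hx3]; gcongr
    have h3 : 2 * x / x ^ 3 = 2 / x ^ 2 := by field_simp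
    linarith
  have hak1 : a / (k : ℝ) ≤ 1 := by
    rw [div_le_one hk0, haR]
    have : (0 : ℝ) ≤ q := Nat.cast_nonneg q
    linarith
  have hak0 : 0 ≤ a / (k : ℝ) := by positivity
  have hsqrt : √N * (a / k) ≤ √(N / k * a) := by
    rw [div_mul_eq_mul_div, mul_div_assoc, Real.sqrt_mul hN.le]
    refine mul_le_mul_of_nonneg_left (Real.le_sqrt_of_sq_le ?_) (Real.sqrt_nonneg N)
    nlinarith
  have hprod : √N * (1 - 7 * (1 / x ^ 2)) ≤ √(N / k * a) * Real.cos (Real.pi / (q + 2)) := by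
    refine le_trans ?_ (mul_le_mul_of_nonneg_right hsqrt hcos0)
    rw [mul_assoc]
    refine mul_le_mul_of_nonneg_left ?_ (Real.sqrt_nonneg N)
    have h5 : 0 ≤ 5 / x ^ 2 := by positivity
    have h7 : 7 * (1 / x ^ 2) = 5 / x ^ 2 + 2 / x ^ 2 := by ring
    have := mul_le_mul_of_nonneg_left hcos hak0
    nlinarith
  rw [hy]
  have : ((a + q : ℕ) : ℝ) ≤ k := by
    rw [haR]; push_cast; linarith
  linarith

end RowState

section Binomial

/-- The binomial distribution. -/
noncomputable def binomialWeight (n : ℕ) (p : ℝ) (m : ℕ) : ℝ :=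
  (n.choose m : ℝ) * p ^ m * (1 - p) ^ (n - m)

lemma eval_bernsteinPolynomial (n : ℕ) (p : ℝ) (m : ℕ) :
    (bernsteinPolynomial ℝ n m).eval p = binomialWeight n p m := by
  simp [bernsteinPolynomial, binomialWeight]

lemma binomialWeight_nonneg (n : ℕ) {p : ℝ} (hp : 0 ≤ p) (hp1 : p ≤ 1) (m : ℕ) :
    0 ≤ binomialWeight n p m := by
  have : 0 ≤ 1 - p := by linarith
  unfold binomialWeight
  positivity

lemma sum_binomialWeight (n : ℕ) (p : ℝ) :
    ∑ m ∈ Finset.range (n + 1), binomialWeight n p m = 1 := by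
  have h := congrArg (Polynomial.eval p) (bernsteinPolynomial.sum ℝ n)
  simpa [Polynomial.eval_finsetSum, eval_bernsteinPolynomial] using h

lemma sum_mul_binomialWeight (n : ℕ) (p : ℝ) :
    ∑ m ∈ Finset.range (n + 1), (m : ℝ) * binomialWeight n p m = p * n := by
  have h := congrArg (Polynomial.eval p) (bernsteinPolynomial.sum_smul ℝ n)
  simpa [Polynomial.eval_finsetSum, eval_bernsteinPolynomial, mul_comm] using h

lemma sum_sq_mul_binomialWeight (n : ℕ) (p : ℝ) :
    ∑ m ∈ Finset.range (n + 1), ((m : ℝ) - p * n) ^ 2 * binomialWeight n p m =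
      p * n * (1 - p) := by
  have h := congrArg (Polynomial.eval p) (bernsteinPolynomial.variance ℝ n)
  simp only [Polynomial.eval_finsetSum, Polynomial.eval_mul, Polynomial.eval_pow,
    Polynomial.eval_sub, Polynomial.eval_natCast, eval_bernsteinPolynomial, nsmul_eq_mul,
    Polynomial.eval_X, Polynomial.eval_one] at h
  rw [mul_comm p, ← h]
  exact Finset.sum_congr rfl fun m _ => by ring

end Binomial

lemma hasSum_sq_mul_poissonWeight (t : ℝ) :
    HasSum (fun z : ℕ => ((z : ℝ) - t) ^ 2 * poissonWeight t z) t := by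
  have hX : poissonMean t Polynomial.X = t := by
    simpa [poissonMean_one] using poissonMean_X_mul_comp t 1
  have hX2 : poissonMean t (Polynomial.X * Polynomial.X) = t * (t + 1) := by
    rw [poissonMean_X_mul_comp, Polynomial.X_comp, map_add, hX, poissonMean_one]
  have h : poissonMean t ((Polynomial.X - Polynomial.C t) ^ 2) = t := by
    have h1 : (Polynomial.X - Polynomial.C t) ^ 2 =
        Polynomial.X * Polynomial.X - (2 * t) • Polynomial.X + (t ^ 2) • (1 : Polynomial ℝ) := by
      simp only [Polynomial.smul_eq_C_mul, map_mul, map_pow, Polynomial.C_ofNat]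
      ring
    rw [h1, map_add, map_sub, map_smul, map_smul, hX, hX2, poissonMean_one, smul_eq_mul,
      smul_eq_mul]
    ring
  have h2 := hasSum_poissonMean t ((Polynomial.X - Polynomial.C t) ^ 2)
  rw [h] at h2
  simpa using h2

lemma two_mul_sqrt_le {A : ℝ} (hA : 0 < A) {x : ℝ} (hx : 0 ≤ x) : 2 * √x ≤ x / A + A := by
  have h1 : √x ^ 2 = x := Real.sq_sqrt hx
  rw [← sub_le_iff_le_add, le_div_iff₀ hA]
  nlinarith [sq_nonneg (√x - A)]

namespace RowState

lemma expLNDS_add_le {k : ℕ} (hk : 1 ≤ k) (a b : ℕ) :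
    expLNDS k (a + b) ≤ expLNDS k a + expLNDS k b := by
  have hk0 : (0 : ℝ) < k := by exact_mod_cast hk
  rw [expLNDS_eq, expLNDS_eq, expLNDS_eq, div_add_div _ _ (by positivity) (by positivity),
    ← pow_add]
  refine div_le_div_of_nonneg_right ?_ (by positivity)
  have : (totalLNDS k (a + b) : ℝ) ≤ k ^ a * totalLNDS k b + k ^ b * totalLNDS k a := by
    exact_mod_cast totalLNDS_add_le k a b
  linarith

lemma expLNDS_le_add {k : ℕ} (hk : 1 ≤ k) (a b : ℕ) : expLNDS k a ≤ expLNDS k (a + b) := by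
  have hk0 : (0 : ℝ) < k := by exact_mod_cast hk
  rw [expLNDS_eq, expLNDS_eq, div_le_div_iff₀ (by positivity) (by positivity), pow_add]
  have : (k : ℝ) ^ b * totalLNDS k a ≤ totalLNDS k (a + b) := by
    exact_mod_cast le_totalLNDS_add k a b
  have := mul_le_mul_of_nonneg_left this (show (0 : ℝ) ≤ (k : ℝ) ^ a by positivity)
  linarith

lemma expLNDS_le_expLNDS_add {k : ℕ} (hk : 1 ≤ k) {N A : ℝ} (hA : 0 < A) (m M : ℕ) :
    expLNDS k M ≤ expLNDS k m +
      (((M - N) ^ 2 + (m - N) ^ 2) / A + A / 2) * (1 / k + 1 / √A) + √A := by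
  have hk0 : (0 : ℝ) < k := by exact_mod_cast hk
  have hsA : 0 < √A := Real.sqrt_pos.2 hA
  rcases le_total M m with h | h
  · obtain ⟨d, rfl⟩ := Nat.exists_eq_add_of_le h
    have := expLNDS_le_add hk M d
    have h2 : 0 ≤ ((M - N) ^ 2 + ((M + d : ℕ) - N) ^ 2) / A + A / 2 := by positivity
    have h3 : 0 ≤ 1 / (k : ℝ) + 1 / √A := by positivity
    have := mul_nonneg h2 h3
    linarith
  · obtain ⟨d, rfl⟩ := Nat.exists_eq_add_of_le h
    have h1 := expLNDS_add_le hk m d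
    have h2 := expLNDS_le hk d
    have h3 := two_mul_sqrt_le hsA (Nat.cast_nonneg (α := ℝ) d)
    have h4 : (d : ℝ) ≤ (((m + d : ℕ) - N) ^ 2 + (m - N) ^ 2) / A + A / 2 := by
      rw [← sub_le_iff_le_add, le_div_iff₀ hA]
      push_cast
      nlinarith [sq_nonneg ((d : ℝ) - A), sq_nonneg (m + d - N + (m - N))]
    have h5 := mul_le_mul_of_nonneg_right h4 (show 0 ≤ 1 / (k : ℝ) + 1 / √A by positivity)
    have h6 : (d : ℝ) * (1 / k + 1 / √A) = d / k + d / √A := by ring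
    linarith

lemma expLNDSBinom_eq (k n : ℕ) (p : ℝ) :
    expLNDSBinom k n p = ∑ m ∈ Finset.range (n + 1), binomialWeight n p m * expLNDS k m := rfl

lemma expLNDSBinom_le {k n : ℕ} {p : ℝ} (hk : 1 ≤ k) (hp : 0 ≤ p) (hp1 : p ≤ 1)
    (hN : 0 < p * n) : expLNDSBinom k n p ≤ p * n / k + 2 * √(p * n) := by
  have hA : 0 < √(p * n) := Real.sqrt_pos.2 hN
  calc expLNDSBinom k n p
      ≤ ∑ m ∈ Finset.range (n + 1), ((m * binomialWeight n p m) * (1 / k + 1 / √(p * n)) +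
          binomialWeight n p m * √(p * n)) := by
        rw [expLNDSBinom_eq]
        refine Finset.sum_le_sum fun m _ => ?_
        have h1 : expLNDS k m ≤ m / k + (m / √(p * n) + √(p * n)) :=
          (expLNDS_le hk m).trans
            (by linarith [two_mul_sqrt_le hA (Nat.cast_nonneg (α := ℝ) m)])
        have := mul_le_mul_of_nonneg_left h1 (binomialWeight_nonneg n hp hp1 m)
        linear_combination this
    _ = p * n / k + 2 * √(p * n) := by
        rw [Finset.sum_add_distrib, ← Finset.sum_mul, ← Finset.sum_mul, sum_mul_binomialWeight,
          sum_binomialWeight]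
        have : p * n * (1 / √(p * n)) = √(p * n) := by
          rw [mul_one_div, Real.div_sqrt]
        linear_combination this

/-- De-Poissonization. -/
lemma tsum_le_expLNDSBinom_add {k n : ℕ} {p : ℝ} (hk : 1 ≤ k) (hp : 0 ≤ p) (hp1 : p ≤ 1)
    (hN : 0 < p * n) :
    ∑' m, poissonWeight (p * n) m * expLNDS k m ≤ expLNDSBinom k n p +
      5 / 2 * √(p * n) / k + 7 / 2 * √√(p * n) := by
  set N := p * n with hNdef
  set A := √N with hAdef
  have hA : 0 < A := Real.sqrt_pos.2 hN
  have hsA : 0 < √A := Real.sqrt_pos.2 hA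
  have hAA : A ^ 2 = N := Real.sq_sqrt hN.le
  have hBB : √A ^ 2 = A := Real.sq_sqrt hA.le
  set D := 1 / (k : ℝ) + 1 / √A with hD
  have hD0 : 0 ≤ D := by positivity
  set T := ∑' m, poissonWeight N m * expLNDS k m
  have hone : HasSum (poissonWeight N) 1 := by
    simpa [poissonMean_one] using hasSum_poissonMean N 1
  have hm (m : ℕ) : T ≤ expLNDS k m + (N / A + (m - N) ^ 2 / A + A / 2) * D + √A := by
    have h1 := ((hasSum_sq_mul_poissonWeight N).mul_right (D / A)).add
      (hone.mul_right (expLNDS k m + ((m - N) ^ 2 / A + A / 2) * D + √A))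
    have h2 := hasSum_le (fun M => ?_)
      (summable_poissonWeight_mul_expLNDS hk hN.le).hasSum h1
    · refine h2.trans (le_of_eq ?_)
      ring
    · have := mul_le_mul_of_nonneg_left (expLNDS_le_expLNDS_add hk (N := N) hA m M)
        (poissonWeight_nonneg hN.le M)
      linear_combination this
  have hsum : ∑ m ∈ Finset.range (n + 1), binomialWeight n p m * T ≤
      ∑ m ∈ Finset.range (n + 1), (binomialWeight n p m * expLNDS k m +
        ((m - N) ^ 2 * binomialWeight n p m) * (D / A) +
        binomialWeight n p m * ((N / A + A / 2) * D + √A)) := by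
    refine Finset.sum_le_sum fun m _ => ?_
    have := mul_le_mul_of_nonneg_left (hm m) (binomialWeight_nonneg n hp hp1 m)
    linear_combination this
  rw [Finset.sum_add_distrib, Finset.sum_add_distrib, ← Finset.sum_mul, ← Finset.sum_mul,
    ← Finset.sum_mul, sum_binomialWeight, sum_sq_mul_binomialWeight, ← expLNDSBinom_eq,
    ← hNdef] at hsum
  have h1 : N * (1 - p) * (D / A) ≤ A * D := by
    have : N * (1 - p) * (D / A) = (1 - p) * (A * D) := by
      rw [← hAA]; field_simp
    rw [this]
    have : 0 ≤ A * D := by positivity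
    nlinarith
  have h2 : N / A = A := by rw [← hAA]; field_simp
  have h3 : A * D = A / k + √A := by
    have : A / √A = √A := Real.div_sqrt
    rw [hD]
    linear_combination this
  rw [h2] at hsum
  clear_value D
  linear_combination hsum + h1 + 5 / 2 * h3

lemma le_expLNDSBinom {k n : ℕ} {p : ℝ} (hk : 1 ≤ k) (hp : 0 ≤ p) (hp1 : p ≤ 1)
    (hN : 0 < p * n) :
    p * n / k + 2 * √(p * n) - (20 * √(p * n) * (k : ℝ) ^ (-(2 : ℝ) / 3) + 5 * (k : ℝ) ^ 2) ≤
      expLNDSBinom k n p := by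
  have h := (le_tsum_poissonWeight_mul_expLNDS hk hN).trans (tsum_le_expLNDSBinom_add hk hp hp1 hN)
  have hk1 : (1 : ℝ) ≤ k := by exact_mod_cast hk
  have hk0 : (0 : ℝ) < k := by linarith
  set A := √(p * n) with hAdef
  set y := (k : ℝ) ^ (-(2 : ℝ) / 3) with hy
  have hA : 0 < A := Real.sqrt_pos.2 hN
  have hBB : √A ^ 2 = A := Real.sq_sqrt hA.le
  have hy0 : 0 < y := Real.rpow_pos_of_pos hk0 _
  have hky : 1 / (k : ℝ) ≤ y := by
    rw [hy, one_div, ← Real.rpow_neg_one]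
    exact Real.rpow_le_rpow_of_exponent_le hk1 (by norm_num)
  have hkk : (k : ℝ) ≤ k ^ 2 := by nlinarith
  have hyk : 1 ≤ y * k ^ 2 := by
    have := mul_le_mul_of_nonneg_right hky hk0.le
    rw [one_div_mul_cancel hk0.ne'] at this
    nlinarith
  have h1 : A / k ≤ A * y := by
    rw [div_eq_mul_one_div]
    exact mul_le_mul_of_nonneg_left hky hA.le
  have h2 : √A ≤ A * y + k ^ 2 := by
    have hB0 := Real.sqrt_nonneg A
    rcases le_total 1 (√A * y) with h' | h'
    · have : √A * 1 ≤ √A * (√A * y) := mul_le_mul_of_nonneg_left h' hB0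
      nlinarith
    · have : √A ≤ k ^ 2 := by
        refine le_of_mul_le_mul_right ?_ hy0
        linarith
      nlinarith [mul_pos hA hy0]
  have h3 : 5 / 2 * A / k = 5 / 2 * (A / k) := by ring
  have : 0 ≤ A * y := by positivity
  nlinarith

end RowState

/-- There are absolute constants `C, C' > 0` such that for all integers
`k ≥ 1`, `n ≥ 2` and all `p ∈ (0, 1]` with `p·n/log n ≥ C'`: if `m ~ Binom(n, p)` and then
`w ~ [k]^m`, then `|E[LNDS(w)] − pn/k − 2√(pn)| ≤ 2√(pn) · C · (k^{-2/3} + (k² + k log(pn))/(pn)^{1/2})`. -/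
theorem stmt12 :
    ∃ C C' : ℝ, 0 < C ∧ 0 < C' ∧
      ∀ (k n : ℕ) (p : ℝ), 1 ≤ k → 2 ≤ n → 0 < p → p ≤ 1 →
        C' ≤ p * n / Real.log n →
        |expLNDSBinom k n p - p * n / k - 2 * Real.sqrt (p * n)| ≤
          2 * Real.sqrt (p * n) * C *
            ((k : ℝ) ^ (-(2 : ℝ) / 3) +
              ((k : ℝ) ^ 2 + k * Real.log (p * n)) / Real.sqrt (p * n)) := by
  refine ⟨10, 2, by norm_num, by norm_num, fun k n p hk hn hp hp1 hC => ?_⟩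
  have hn2 : (2 : ℝ) ≤ n := by exact_mod_cast hn
  have hlog : Real.log 2 ≤ Real.log n := Real.log_le_log two_pos hn2
  have hlog2 := Real.log_two_gt_d9
  have hN1 : 1 ≤ p * n := by
    rw [le_div_iff₀ (by linarith)] at hC
    linarith
  have hN : 0 < p * n := by linarith
  have hA : 0 < Real.sqrt (p * n) := Real.sqrt_pos.2 hN
  have hupper := RowState.expLNDSBinom_le hk hp.le hp1 hN
  have hlower := RowState.le_expLNDSBinom hk hp.le hp1 hN
  have hrhs : 2 * Real.sqrt (p * n) * 10 * ((k : ℝ) ^ (-(2 : ℝ) / 3) +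
      ((k : ℝ) ^ 2 + k * Real.log (p * n)) / Real.sqrt (p * n)) =
      20 * Real.sqrt (p * n) * (k : ℝ) ^ (-(2 : ℝ) / 3) +
        20 * ((k : ℝ) ^ 2 + k * Real.log (p * n)) := by
    field_simp
    ring
  have hlogN : 0 ≤ k * Real.log (p * n) := mul_nonneg (Nat.cast_nonneg k) (Real.log_nonneg hN1)
  have hy : 0 ≤ Real.sqrt (p * n) * (k : ℝ) ^ (-(2 : ℝ) / 3) := by positivity
  have hk2 : 0 ≤ (k : ℝ) ^ 2 := by positivity
  rw [hrhs, abs_le]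
  constructor <;> linarith
end
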